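/- Fix ε ∈ (0, 1/4), and let s, t : ℕ → ℝ be sequences such that P(χ(G(n,1/2)) ∈ [s_n, t_n]) → 1 as n → ∞. For n with ε < x(n) < 1/2 − ε set r = ⌊n^{x(n)/2}⌋ and n′ = n + r·a(n). Let X_a (resp. X′_a) be the number of independent a(n)-sets in G(n,1/2) (resp. G(n′,1/2)), and let E (resp. E′) be the event that all independent a(n)-sets are pairwise disjoint. Then there is N such that for every n ≥ N with ε < x(n) < 1/2 − ε, there exists an integer A ∈ [n^{x(n)}/2, 2·n^{x(n)}] such that P( χ(G(n,1/2)) ∈ [s_n, t_n] | {X_a = A} ∩ E ) > 3/4 and P( χ(G(n′,1/2)) ∈ [s_{n′}, t_{n′}] | {X′_a = A + r} ∩ E′ ) > 3/4. -/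

import Mathlib

open Filter

/-- The chromatic number of a graph on `Fin n`, as a natural number. -/
noncomputable def chi (n : ℕ) (G : SimpleGraph (Fin n)) : ℕ := G.chromaticNumber.toNat

/-- Probability of an event under `G(n,1/2)`, i.e. the uniform measure on all
simple graphs on `{1,…,n}` (each edge present independently with probability 1/2). -/
noncomputable def Pr (n : ℕ) (B : SimpleGraph (Fin n) → Prop) : ℝ :=
  (Nat.card {G : SimpleGraph (Fin n) // B G} : ℝ) / (Nat.card (SimpleGraph (Fin n)) : ℝ)

/-- Conditional probability `P(B | C)` under `G(n,1/2)` (a ratio of counts, since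
the `G(n,1/2)` measure is uniform). -/
noncomputable def condPr (n : ℕ) (B C : SimpleGraph (Fin n) → Prop) : ℝ :=
  (Nat.card {G : SimpleGraph (Fin n) // C G ∧ B G} : ℝ) /
    (Nat.card {G : SimpleGraph (Fin n) // C G} : ℝ)

/-- A vertex set is independent if it spans no edges of the graph. -/
def IndepSet {n : ℕ} (G : SimpleGraph (Fin n)) (T : Finset (Fin n)) : Prop :=
  ∀ u ∈ T, ∀ v ∈ T, ¬ G.Adj u v

/-- The number of independent `k`-sets of a graph. -/
noncomputable def numIndep (n k : ℕ) (G : SimpleGraph (Fin n)) : ℕ :=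
  Nat.card {T : Finset (Fin n) // T.card = k ∧ IndepSet G T}

/-- All independent `k`-sets of `G` are pairwise disjoint. -/
def AllDisjoint (n k : ℕ) (G : SimpleGraph (Fin n)) : Prop :=
  ∀ S T : Finset (Fin n), S.card = k → T.card = k →
    IndepSet G S → IndepSet G T → S ≠ T → Disjoint S T

/-- `α₀(n) = 2 log₂ n − 2 log₂ log₂ n + 2 log₂ (e/2) + 1`. -/
noncomputable def alpha0 (n : ℕ) : ℝ :=
  2 * Real.logb 2 n - 2 * Real.logb 2 (Real.logb 2 n)
    + 2 * Real.logb 2 (Real.exp 1 / 2) + 1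

/-- `a(n) = ⌊α₀(n)⌋`. -/
noncomputable def aa (n : ℕ) : ℕ := ⌊alpha0 n⌋₊

/-- `μ(n) = C(n, a(n)) · 2^{−a(n)(a(n)−1)/2}`. -/
noncomputable def mu (n : ℕ) : ℝ :=
  (n.choose (aa n) : ℝ) * (2 : ℝ)⁻¹ ^ ((aa n).choose 2)

/-- `x(n) = log μ(n) / log n`, so that `μ(n) = n^{x(n)}`. -/
noncomputable def xx (n : ℕ) : ℝ := Real.log (mu n) / Real.log n

section Graphs
open Classical

noncomputable def Ex (m : ℕ) (f : SimpleGraph (Fin m) → ℝ) : ℝ :=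
  (∑ G, f G) / (Fintype.card (SimpleGraph (Fin m)) : ℝ)

noncomputable def ind (p : Prop) : ℝ := if p then 1 else 0

lemma ind_nonneg (p : Prop) : 0 ≤ ind p := by unfold ind; split_ifs <;> norm_num

lemma ind_le_one (p : Prop) : ind p ≤ 1 := by unfold ind; split_ifs <;> norm_num

lemma ind_mono {p q : Prop} (h : p → q) : ind p ≤ ind q := by
  unfold ind; split_ifs <;> first | tauto | norm_num

lemma card_pos_graph (m : ℕ) : (0 : ℝ) < (Fintype.card (SimpleGraph (Fin m)) : ℝ) := by
  exact_mod_cast Fintype.card_pos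

lemma Ex_mono {m : ℕ} {f g : SimpleGraph (Fin m) → ℝ} (h : ∀ G, f G ≤ g G) : Ex m f ≤ Ex m g := by
  unfold Ex
  exact div_le_div_of_nonneg_right (Finset.sum_le_sum fun G _ => h G) (card_pos_graph m).le

lemma Ex_add {m : ℕ} (f g : SimpleGraph (Fin m) → ℝ) :
    Ex m (fun G => f G + g G) = Ex m f + Ex m g := by
  unfold Ex; rw [Finset.sum_add_distrib, add_div]

lemma Ex_sub {m : ℕ} (f g : SimpleGraph (Fin m) → ℝ) :
    Ex m (fun G => f G - g G) = Ex m f - Ex m g := by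
  unfold Ex; rw [Finset.sum_sub_distrib, sub_div]

lemma Ex_mul {m : ℕ} (c : ℝ) (f : SimpleGraph (Fin m) → ℝ) :
    Ex m (fun G => c * f G) = c * Ex m f := by
  unfold Ex; rw [← Finset.mul_sum, mul_div_assoc]

lemma Ex_const {m : ℕ} (c : ℝ) : Ex m (fun _ => c) = c := by
  unfold Ex
  have := card_pos_graph m
  simp only [Finset.sum_const, Finset.card_univ, nsmul_eq_mul]
  field_simp

lemma Ex_sum {m : ℕ} {ι : Type*} (s : Finset ι) (f : ι → SimpleGraph (Fin m) → ℝ) :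
    Ex m (fun G => ∑ i ∈ s, f i G) = ∑ i ∈ s, Ex m (f i) := by
  unfold Ex; rw [Finset.sum_comm, Finset.sum_div]

lemma Ex_abs {m : ℕ} (f : SimpleGraph (Fin m) → ℝ) : |Ex m f| ≤ Ex m (fun G => |f G|) := by
  unfold Ex
  rw [abs_div, abs_of_pos (card_pos_graph m)]
  exact div_le_div_of_nonneg_right (Finset.abs_sum_le_sum_abs _ _) (card_pos_graph m).le

lemma Ex_nonneg {m : ℕ} {f : SimpleGraph (Fin m) → ℝ} (h : ∀ G, 0 ≤ f G) : 0 ≤ Ex m f := by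
  have := Ex_mono (m := m) (f := fun _ => 0) (g := f) h
  rwa [Ex_const] at this

lemma Pr_eq (m : ℕ) (B : SimpleGraph (Fin m) → Prop) : Pr m B = Ex m (fun G => ind (B G)) := by
  unfold Pr Ex ind
  rw [Nat.card_eq_fintype_card, Nat.card_eq_fintype_card, Fintype.card_subtype]
  simp

lemma condPr_eq (m : ℕ) (B C : SimpleGraph (Fin m) → Prop) :
    condPr m B C = Pr m (fun G => C G ∧ B G) / Pr m C := by
  unfold condPr Pr
  have : (Nat.card (SimpleGraph (Fin m)) : ℝ) ≠ 0 := by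
    rw [Nat.card_eq_fintype_card]; exact (card_pos_graph m).ne'
  field_simp

/-- edges inside T -/
noncomputable def FF {m : ℕ} (T : Finset (Fin m)) : Finset (Sym2 (Fin m)) :=
  T.offDiag.image (fun p => s(p.1, p.2))

lemma mem_FF {m : ℕ} (T : Finset (Fin m)) (u v : Fin m) :
    s(u, v) ∈ FF T ↔ u ∈ T ∧ v ∈ T ∧ u ≠ v := by
  unfold FF
  simp only [Finset.mem_image, Finset.mem_offDiag, Prod.exists, Sym2.eq_iff]
  constructor
  · rintro ⟨a, b, ⟨ha, hb, hab⟩, (⟨rfl, rfl⟩ | ⟨rfl, rfl⟩)⟩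
    · exact ⟨ha, hb, hab⟩
    · exact ⟨hb, ha, hab.symm⟩
  · rintro ⟨h1, h2, h3⟩
    exact ⟨u, v, ⟨h1, h2, h3⟩, Or.inl ⟨rfl, rfl⟩⟩

lemma card_FF {m : ℕ} (T : Finset (Fin m)) : (FF T).card = T.card.choose 2 := by
  unfold FF
  exact Sym2.card_image_offDiag T

lemma FF_inter {m : ℕ} (S T : Finset (Fin m)) : FF S ∩ FF T = FF (S ∩ T) := by
  ext e
  induction e with
  | _ u v => simp only [Finset.mem_inter, mem_FF]; tauto

lemma FF_notdiag {m : ℕ} (T : Finset (Fin m)) : ∀ e ∈ FF T, ¬ e.IsDiag := by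
  intro e
  induction e with
  | _ u v => rw [mem_FF]; simp

lemma indep_iff {m : ℕ} (G : SimpleGraph (Fin m)) (T : Finset (Fin m)) :
    IndepSet G T ↔ ∀ e ∈ FF T, e ∉ G.edgeSet := by
  constructor
  · intro h e
    induction e with
    | _ u v =>
      rw [mem_FF]; rintro ⟨h1, h2, _⟩; rw [SimpleGraph.mem_edgeSet]; exact h u h1 v h2
  · intro h u hu v hv hadj
    exact h s(u, v) ((mem_FF _ _ _).2 ⟨hu, hv, hadj.ne⟩) hadj

lemma fiber_card {m : ℕ} (F : Finset (Sym2 (Fin m))) (hF : ∀ e ∈ F, ¬ e.IsDiag)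
    (H : SimpleGraph (Fin m)) (hH : ∀ e ∈ F, e ∉ H.edgeSet) :
    (Finset.univ.filter (fun G : SimpleGraph (Fin m) => G.deleteEdges (F : Set _) = H)).card
      = 2 ^ F.card := by
  rw [← Finset.card_powerset]
  symm
  refine Finset.card_bij (fun (F' : Finset (Sym2 (Fin m))) _ => H ⊔ SimpleGraph.fromEdgeSet (F' : Set (Sym2 (Fin m)))) ?_ ?_ ?_
  · intro F' hF'
    rw [Finset.mem_powerset] at hF'
    simp only [Finset.mem_filter, Finset.mem_univ, true_and]
    ext u v
    simp only [SimpleGraph.deleteEdges_adj, SimpleGraph.sup_adj, SimpleGraph.fromEdgeSet_adj,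
      Finset.mem_coe]
    constructor
    · rintro ⟨h1 | h1, h2⟩
      · exact h1
      · exact absurd (hF' h1.1) h2
    · intro h
      exact ⟨Or.inl h, fun h' => hH _ h' h⟩
  · intro F1 h1 F2 h2 heq
    rw [Finset.mem_powerset] at h1 h2
    ext e
    induction e with
    | _ u v =>
      have := congrArg (fun G : SimpleGraph (Fin m) => G.Adj u v) heq
      simp only [SimpleGraph.sup_adj, SimpleGraph.fromEdgeSet_adj, Finset.mem_coe, eq_iff_iff] at this
      constructor
      · intro h
        have hne : u ≠ v := fun h' => hF _ (h1 h) (by simpa using h')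
        rcases this.1 (Or.inr ⟨h, hne⟩) with h' | h'
        · exact absurd h' (hH _ (h1 h))
        · exact h'.1
      · intro h
        have hne : u ≠ v := fun h' => hF _ (h2 h) (by simpa using h')
        rcases this.2 (Or.inr ⟨h, hne⟩) with h' | h'
        · exact absurd h' (hH _ (h2 h))
        · exact h'.1
  · intro G hG
    simp only [Finset.mem_filter, Finset.mem_univ, true_and] at hG
    refine ⟨F.filter (fun e => e ∈ G.edgeSet), by simp, ?_⟩
    subst hG
    ext u v
    simp only [SimpleGraph.deleteEdges_adj, SimpleGraph.sup_adj, SimpleGraph.fromEdgeSet_adj,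
      Finset.mem_coe, Finset.mem_filter, SimpleGraph.mem_edgeSet]
    constructor
    · rintro (h | h)
      · exact h.1
      · exact h.1.2
    · intro h
      by_cases h' : s(u, v) ∈ F
      · exact Or.inr ⟨⟨h', h⟩, h.ne⟩
      · exact Or.inl ⟨h, h'⟩

lemma Ex_del {m : ℕ} (F : Finset (Sym2 (Fin m))) (hF : ∀ e ∈ F, ¬ e.IsDiag)
    (ψ : SimpleGraph (Fin m) → ℝ) :
    Ex m (fun G => ind (∀ e ∈ F, e ∉ G.edgeSet) * ψ G)
      = (2 : ℝ)⁻¹ ^ F.card * Ex m (fun G => ψ (G.deleteEdges (F : Set _))) := by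
  have h : ∑ G : SimpleGraph (Fin m), ψ (G.deleteEdges (F : Set _))
      = 2 ^ F.card * ∑ G : SimpleGraph (Fin m), ind (∀ e ∈ F, e ∉ G.edgeSet) * ψ G := by
    rw [← Finset.sum_fiberwise_of_maps_to (s := Finset.univ)
      (t := Finset.univ.filter (fun H : SimpleGraph (Fin m) => ∀ e ∈ F, e ∉ H.edgeSet))
      (g := fun G => G.deleteEdges (F : Set _))]
    · rw [Finset.mul_sum, Finset.sum_filter]
      apply Finset.sum_congr rfl
      intro H _
      unfold ind
      split_ifs with hH
      · rw [Finset.sum_congr rfl (g := fun _ => ψ H), Finset.sum_const, fiber_card F hF H hH]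
        · simp
        · intro G hG
          rw [(Finset.mem_filter.1 hG).2]
      · simp
    · intro G _
      simp only [Finset.mem_filter, Finset.mem_univ, true_and]
      intro e he
      simp [SimpleGraph.edgeSet_deleteEdges, he]
  unfold Ex
  rw [h]
  have : ((2:ℝ)⁻¹ ^ F.card) * 2 ^ F.card = 1 := by rw [← mul_pow]; norm_num
  rw [mul_div_assoc', ← mul_assoc, this, one_mul]

noncomputable def dl {m : ℕ} (T : Finset (Fin m)) (G : SimpleGraph (Fin m)) : SimpleGraph (Fin m) :=
  G.deleteEdges (FF T : Set _)

lemma Ex_indep_mul {m k : ℕ} (T : Finset (Fin m)) (hT : T.card = k)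
    (ψ : SimpleGraph (Fin m) → ℝ) :
    Ex m (fun G => ind (IndepSet G T) * ψ G)
      = (2 : ℝ)⁻¹ ^ (k.choose 2) * Ex m (fun G => ψ (dl T G)) := by
  simp_rw [indep_iff]
  rw [Ex_del _ (FF_notdiag T), card_FF, hT]
  rfl

lemma Ex_indep {m k : ℕ} (T : Finset (Fin m)) (hT : T.card = k) :
    Ex m (fun G => ind (IndepSet G T)) = (2 : ℝ)⁻¹ ^ (k.choose 2) := by
  have := Ex_indep_mul T hT (fun _ => 1)
  simpa [Ex_const] using this

lemma Ex_two {m k : ℕ} (S T : Finset (Fin m)) (hS : S.card = k) (hT : T.card = k) :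
    Ex m (fun G => ind (IndepSet G S) * ind (IndepSet G T))
      = (2 : ℝ)⁻¹ ^ (k.choose 2) * (2 : ℝ)⁻¹ ^ (k.choose 2) * 2 ^ ((S ∩ T).card.choose 2) := by
  have h1 : ∀ G : SimpleGraph (Fin m), ind (IndepSet G S) * ind (IndepSet G T)
      = ind (∀ e ∈ FF S ∪ FF T, e ∉ G.edgeSet) * 1 := by
    intro G
    rw [indep_iff, indep_iff]
    unfold ind
    simp only [Finset.mem_union, or_imp, forall_and]
    split_ifs <;> first | tauto | norm_num
  simp_rw [h1]
  rw [Ex_del, Ex_const, mul_one]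
  · have h2 := Finset.card_union_add_card_inter (FF S) (FF T)
    rw [FF_inter, card_FF, card_FF, card_FF, hS, hT] at h2
    rw [← pow_add, ← h2, pow_add, mul_assoc, ← mul_pow]
    norm_num
  · intro e he
    rcases Finset.mem_union.1 he with h | h
    · exact FF_notdiag _ _ h
    · exact FF_notdiag _ _ h

lemma numIndep_eq (m k : ℕ) (G : SimpleGraph (Fin m)) :
    (numIndep m k G : ℝ) = ∑ T ∈ Finset.powersetCard k Finset.univ, ind (IndepSet G T) := by
  unfold numIndep ind
  rw [Nat.card_eq_fintype_card, Fintype.card_subtype, Finset.sum_boole]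
  congr 2
  ext T
  simp [Finset.mem_powersetCard]

end Graphs
section Moments
open Classical

noncomputable def muk (m k : ℕ) : ℝ := (m.choose k : ℝ) * (2 : ℝ)⁻¹ ^ (k.choose 2)

noncomputable def DD (m k : ℕ) : ℝ :=
  ∑ l ∈ Finset.Ico 1 k, (k.choose l : ℝ) * (m.choose (k - l) : ℝ) *
    ((2 : ℝ)⁻¹ ^ (k.choose 2) * 2 ^ (l.choose 2))

noncomputable def pik (k : ℕ) : ℝ := (2 : ℝ)⁻¹ ^ (k.choose 2)

lemma pik_pos (k : ℕ) : 0 < pik k := by unfold pik; positivity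

lemma DD_nonneg (m k : ℕ) : 0 ≤ DD m k := by unfold DD; positivity

lemma muk_nonneg (m k : ℕ) : 0 ≤ muk m k := by unfold muk; positivity

lemma sum_const_pik (m k : ℕ) (c : ℝ) :
    ∑ _T ∈ Finset.powersetCard k (Finset.univ : Finset (Fin m)), pik k * c = muk m k * c := by
  rw [Finset.sum_const, Finset.card_powersetCard, Finset.card_univ, Fintype.card_fin, nsmul_eq_mul]
  unfold muk pik
  ring

noncomputable def Nb {m : ℕ} (k : ℕ) (T : Finset (Fin m)) : Finset (Finset (Fin m)) :=
  (Finset.powersetCard k Finset.univ).filter (fun S => S ≠ T ∧ ¬ Disjoint S T)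

lemma fib_card {m k l : ℕ} (T : Finset (Fin m)) (hT : T.card = k) (hl : l ≤ k):
    ((Nb k T).filter (fun S => (S ∩ T).card = l)).card ≤ k.choose l * m.choose (k - l) := by
  have : (Finset.powersetCard l T ×ˢ Finset.powersetCard (k - l) (Finset.univ : Finset (Fin m))).card
      = k.choose l * m.choose (k - l) := by
    rw [Finset.card_product, Finset.card_powersetCard, Finset.card_powersetCard, hT]
    simp
  rw [← this]
  apply Finset.card_le_card_of_injOn (fun S => (S ∩ T, S \ T))
  · intro S hS
    simp only [Nb, Finset.coe_filter, Finset.mem_filter, Finset.mem_powersetCard, Set.mem_ofPred_eq] at hS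
    have h := Finset.card_inter_add_card_sdiff S T
    simp only [Finset.coe_product, Set.mem_prod, Finset.mem_coe, Finset.mem_powersetCard]
    refine ⟨⟨Finset.inter_subset_right, hS.2⟩, Finset.subset_univ _, ?_⟩
    have := hS.1.1.2
    have := hS.2
    omega
  · intro S1 _ S2 _ h
    simp only [Prod.mk.injEq] at h
    rw [← Finset.sdiff_union_inter S1 T, ← Finset.sdiff_union_inter S2 T, h.1, h.2]

lemma pair_sum {m k : ℕ} (T : Finset (Fin m)) (hT : T.card = k) :
    ∑ S ∈ Nb k T, Ex m (fun G => ind (IndepSet G S) * ind (IndepSet G T)) ≤ pik k * DD m k := by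
  have h1 : ∀ S ∈ Nb k T, (S ∩ T).card ∈ Finset.Ico 1 k := by
    intro S hS
    simp only [Nb, Finset.mem_filter, Finset.mem_powersetCard] at hS
    rw [Finset.mem_Ico]
    constructor
    · rw [Nat.one_le_iff_ne_zero, Finset.card_ne_zero]
      rw [Finset.disjoint_iff_inter_eq_empty] at hS
      exact Finset.nonempty_iff_ne_empty.2 hS.2.2
    · have h2 : (S ∩ T).card ≤ S.card := Finset.card_le_card Finset.inter_subset_left
      rcases h2.lt_or_eq with h | h
      · omega
      · exfalso
        have h3 := Finset.eq_of_subset_of_card_le (Finset.inter_subset_left (s₁ := S) (s₂ := T)) h.ge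
        have h4 : S ⊆ T := by rw [← h3]; exact Finset.inter_subset_right
        exact hS.2.1 (Finset.eq_of_subset_of_card_le h4 (by omega))
  rw [← Finset.sum_fiberwise_of_maps_to h1]
  unfold DD
  rw [Finset.mul_sum]
  apply Finset.sum_le_sum
  intro l hl
  rw [Finset.mem_Ico] at hl
  rw [Finset.sum_congr rfl (g := fun _ => pik k * (pik k * 2 ^ (l.choose 2)))]
  · rw [Finset.sum_const, nsmul_eq_mul]
    have h2 := fib_card (l := l) T hT hl.2.le
    have h3 : (((Nb k T).filter (fun S => (S ∩ T).card = l)).card : ℝ)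
      ≤ (k.choose l : ℝ) * (m.choose (k - l) : ℝ) := by exact_mod_cast h2
    have h4 := pik_pos k
    calc _ ≤ ((k.choose l : ℝ) * (m.choose (k - l) : ℝ)) * (pik k * (pik k * 2 ^ (l.choose 2))) := by
          gcongr
      _ = _ := by unfold pik; ring
  · intro S hS
    rw [Finset.mem_filter] at hS
    have hc : S.card = k := by
      have := hS.1
      simp only [Nb, Finset.mem_filter, Finset.mem_powersetCard] at this
      exact this.1.2
    rw [Ex_two S T hc hT, hS.2, mul_assoc]
    rfl

lemma Pr_notdisj (m k : ℕ) :
    Pr m (fun G => ¬ AllDisjoint m k G) ≤ muk m k * DD m k := by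
  rw [Pr_eq, ← sum_const_pik]
  calc _ ≤ Ex m (fun G => ∑ T ∈ Finset.powersetCard k Finset.univ, ∑ S ∈ Nb k T,
        ind (IndepSet G S) * ind (IndepSet G T)) := by
        apply Ex_mono
        intro G
        have hnn : ∀ T ∈ Finset.powersetCard k (Finset.univ : Finset (Fin m)),
          0 ≤ ∑ S ∈ Nb k T, ind (IndepSet G S) * ind (IndepSet G T) := fun T _ =>
            Finset.sum_nonneg fun S _ => mul_nonneg (ind_nonneg _) (ind_nonneg _)
        by_cases h : AllDisjoint m k G
        · rw [ind, if_neg (by simpa using h)]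
          exact Finset.sum_nonneg hnn
        · rw [ind, if_pos h]
          unfold AllDisjoint at h
          push Not at h
          obtain ⟨S, T, hS, hT, iS, iT, hne, hd⟩ := h
          have hTm : T ∈ Finset.powersetCard k (Finset.univ : Finset (Fin m)) := by
            simp [Finset.mem_powersetCard, hT]
          have hSm : S ∈ Nb k T := by
            simp [Nb, Finset.mem_powersetCard, hS, hne, hd]
          refine le_trans ?_ (Finset.single_le_sum hnn hTm)
          refine le_trans ?_ (Finset.single_le_sum
            (fun S _ => mul_nonneg (ind_nonneg _) (ind_nonneg _)) hSm)
          simp [ind, iS, iT]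
    _ ≤ _ := by
        rw [Ex_sum]
        apply Finset.sum_le_sum
        intro T hT
        rw [Ex_sum]
        exact pair_sum T (Finset.mem_powersetCard.1 hT).2

lemma Ex_X (m k : ℕ) : Ex m (fun G => (numIndep m k G : ℝ)) = muk m k := by
  simp_rw [numIndep_eq]
  rw [Ex_sum, ← mul_one (muk m k), ← sum_const_pik]
  apply Finset.sum_congr rfl
  intro T hT
  rw [Ex_indep T (Finset.mem_powersetCard.1 hT).2, mul_one]
  rfl

lemma Ex_X2 (m k : ℕ) : Ex m (fun G => (numIndep m k G : ℝ) ^ 2)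
    ≤ muk m k ^ 2 + muk m k * DD m k + muk m k := by
  simp_rw [numIndep_eq, sq, Finset.sum_mul_sum]
  rw [Ex_sum]
  have : muk m k * muk m k + muk m k * DD m k + muk m k = muk m k * (muk m k + DD m k + 1) := by ring
  rw [this, ← sum_const_pik]
  apply Finset.sum_le_sum
  intro T hT
  have hTc := (Finset.mem_powersetCard.1 hT).2
  rw [Ex_sum]
  have hsplit : ∀ S ∈ Finset.powersetCard k (Finset.univ : Finset (Fin m)),
      Ex m (fun G => ind (IndepSet G T) * ind (IndepSet G S)) ≤
       pik k * pik k + (if S ≠ T ∧ ¬ Disjoint S T then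
         Ex m (fun G => ind (IndepSet G S) * ind (IndepSet G T)) else 0)
         + (if S = T then pik k else 0) := by
    intro S hS
    have hSc := (Finset.mem_powersetCard.1 hS).2
    have hp := pik_pos k
    have hpp := mul_pos hp hp
    by_cases h1 : S = T
    · subst h1
      simp only [ne_eq, not_true_eq_false, false_and, if_false, if_true]
      have : Ex m (fun G => ind (IndepSet G S) * ind (IndepSet G S)) = pik k := by
        refine Eq.trans ?_ (Ex_indep (k := k) S hSc)
        congr 1; ext G; unfold ind; split_ifs <;> norm_num
      rw [this]; linarith
    · by_cases h2 : Disjoint S T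
      · simp only [h1, h2, if_false, not_true_eq_false, and_false]
        rw [Ex_two T S hTc hSc, Finset.disjoint_iff_inter_eq_empty.1 h2.symm]
        simp [pik]
      · simp only [h1, h2, ne_eq, not_false_eq_true, and_self, if_true, if_false]
        have : Ex m (fun G => ind (IndepSet G T) * ind (IndepSet G S))
          = Ex m (fun G => ind (IndepSet G S) * ind (IndepSet G T)) := by
          congr 1; ext G; ring
        rw [this]; linarith
  refine (Finset.sum_le_sum hsplit).trans ?_
  rw [Finset.sum_add_distrib, Finset.sum_add_distrib, sum_const_pik, ← Finset.sum_filter,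
    Finset.sum_ite_eq' , if_pos hT]
  have := pair_sum T hTc
  unfold Nb at this
  have h3 : muk m k * pik k = pik k * muk m k := by ring
  linarith

lemma var_X (m k : ℕ) : Ex m (fun G => ((numIndep m k G : ℝ) - muk m k) ^ 2)
    ≤ muk m k * (1 + DD m k) := by
  have h : ∀ G : SimpleGraph (Fin m), ((numIndep m k G : ℝ) - muk m k) ^ 2
    = ((numIndep m k G : ℝ) ^ 2 + muk m k ^ 2) - (2 * muk m k) * (numIndep m k G : ℝ) := by
    intro G; ring
  simp_rw [h]
  rw [Ex_sub, Ex_add, Ex_const, Ex_mul, Ex_X]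
  have := Ex_X2 m k
  nlinarith

lemma indep_dl {m : ℕ} (S T : Finset (Fin m)) (G : SimpleGraph (Fin m)) (h : IndepSet G S) :
    IndepSet (dl T G) S := by
  intro u hu v hv hadj
  exact h u hu v hv (SimpleGraph.deleteEdges_le _ hadj)

lemma indep_dl_self {m : ℕ} (T : Finset (Fin m)) (G : SimpleGraph (Fin m)) :
    IndepSet (dl T G) T := by
  intro u hu v hv hadj
  unfold dl at hadj
  rw [SimpleGraph.deleteEdges_adj] at hadj
  apply hadj.2
  rw [Finset.mem_coe, mem_FF]
  exact ⟨hu, hv, hadj.1.ne⟩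

lemma indep_dl_disj {m : ℕ} (S T : Finset (Fin m)) (G : SimpleGraph (Fin m)) (hd : Disjoint S T)
    (h : IndepSet (dl T G) S) : IndepSet G S := by
  intro u hu v hv hadj
  apply h u hu v hv
  unfold dl
  rw [SimpleGraph.deleteEdges_adj]
  refine ⟨hadj, ?_⟩
  rw [Finset.mem_coe, mem_FF]
  rintro ⟨h1, _⟩
  exact Finset.disjoint_left.1 hd hu h1

lemma X_dl {m k : ℕ} (T : Finset (Fin m)) (hT : T.card = k) (G : SimpleGraph (Fin m)) :
    ind (numIndep m k (dl T G) ≠ numIndep m k G + 1) ≤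
      ind (IndepSet G T) + ∑ S ∈ Nb k T, ind (IndepSet (dl T G) S) := by
  have hTm : T ∈ Finset.powersetCard k (Finset.univ : Finset (Fin m)) := by
    simp [Finset.mem_powersetCard, hT]
  by_cases h1 : IndepSet G T
  · have : 0 ≤ ∑ S ∈ Nb k T, ind (IndepSet (dl T G) S) :=
      Finset.sum_nonneg fun S _ => ind_nonneg _
    have h2 := ind_le_one (numIndep m k (dl T G) ≠ numIndep m k G + 1)
    have h3 : ind (IndepSet G T) = 1 := by simp [ind, h1]
    linarith
  by_cases h2 : ∃ S ∈ Nb k T, IndepSet (dl T G) S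
  · obtain ⟨S, hS, hi⟩ := h2
    have h2 := ind_le_one (numIndep m k (dl T G) ≠ numIndep m k G + 1)
    have h3 := Finset.single_le_sum (f := fun S => ind (IndepSet (dl T G) S))
      (fun S _ => ind_nonneg _) hS
    have h4 : ind (IndepSet (dl T G) S) = 1 := by simp [ind, hi]
    have := ind_nonneg (IndepSet G T)
    simp only [h4] at h3
    linarith
  · push Not at h2
    have key : (numIndep m k (dl T G) : ℝ) = numIndep m k G + 1 := by
      rw [numIndep_eq, numIndep_eq, ← Finset.add_sum_erase _ _ hTm,
        ← Finset.add_sum_erase (Finset.powersetCard k Finset.univ) (fun S => ind (IndepSet G S)) hTm]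
      have e1 : ind (IndepSet (dl T G) T) = 1 := by simp [ind, indep_dl_self]
      have e2 : ind (IndepSet G T) = 0 := by simp [ind, h1]
      simp only [e1, e2]
      rw [zero_add, add_comm]
      congr 1
      apply Finset.sum_congr rfl
      intro S hS
      rw [Finset.mem_erase] at hS
      have : IndepSet (dl T G) S ↔ IndepSet G S := by
        constructor
        · intro h
          by_cases hd : Disjoint S T
          · exact indep_dl_disj S T G hd h
          · exact absurd h (h2 S (by unfold Nb; rw [Finset.mem_filter]; exact ⟨hS.2, hS.1, hd⟩))
        · exact indep_dl S T G
      rw [this]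
    have key' : numIndep m k (dl T G) = numIndep m k G + 1 := by exact_mod_cast key
    rw [ind, if_neg (by simpa using key')]
    exact add_nonneg (ind_nonneg _) (Finset.sum_nonneg fun S _ => ind_nonneg _)

lemma Ex_X_dl {m k : ℕ} (T : Finset (Fin m)) (hT : T.card = k) :
    Ex m (fun G => ind (numIndep m k (dl T G) ≠ numIndep m k G + 1)) ≤ pik k + DD m k := by
  refine (Ex_mono (X_dl T hT)).trans ?_
  rw [Ex_add, Ex_sum, Ex_indep T hT]
  have h := pair_sum (m := m) T hT
  have h2 : ∀ S ∈ Nb k T, Ex m (fun G => ind (IndepSet G S) * ind (IndepSet G T))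
      = pik k * Ex m (fun G => ind (IndepSet (dl T G) S)) := by
    intro S _
    have := Ex_indep_mul T hT (fun G => ind (IndepSet G S))
    simp_rw [mul_comm] at this ⊢
    exact this
  rw [Finset.sum_congr rfl h2, ← Finset.mul_sum] at h
  have := le_of_mul_le_mul_left h (pik_pos k)
  unfold pik
  linarith

lemma sum_ind_le_one (N : ℕ) (P : ℕ → Prop) (h : ∀ x y, P x → P y → x = y) :
    ∑ A ∈ Finset.range N, ind (P A) ≤ 1 := by
  unfold ind
  rw [Finset.sum_boole, Nat.cast_le_one, Finset.card_le_one]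
  intro x hx y hy
  simp only [Finset.mem_filter] at hx hy
  exact h x y hx.2 hy.2

lemma sum_abs_ind (N a b : ℕ) :
    ∑ A ∈ Finset.range N, |ind (b = A + 1) - ind (a = A)| ≤ 2 * ind (b ≠ a + 1) := by
  by_cases h : b = a + 1
  · subst h
    apply (Finset.sum_eq_zero _).le.trans (by have := ind_nonneg (a + 1 ≠ a + 1); linarith)
    intro A _
    simp
  · rw [ind.eq_1 (b ≠ a + 1), if_pos h]
    calc _ ≤ ∑ A ∈ Finset.range N, (ind (b = A + 1) + ind (a = A)) := by
          apply Finset.sum_le_sum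
          intro A _
          have h1 := ind_nonneg (b = A + 1)
          have h2 := ind_nonneg (a = A)
          rw [abs_le]; constructor <;> linarith
      _ ≤ 1 + 1 := by
          rw [Finset.sum_add_distrib]
          exact add_le_add (sum_ind_le_one N _ fun x y hx hy => by omega)
            (sum_ind_le_one N _ fun x y hx hy => by omega)
      _ = _ := by norm_num

lemma stein (m k N : ℕ) :
    ∑ A ∈ Finset.range N, |((A : ℝ) + 1) * Pr m (fun G => numIndep m k G = A + 1)
      - muk m k * Pr m (fun G => numIndep m k G = A)| ≤ 2 * muk m k * (pik k + DD m k) := by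
  have h1 : ∀ A : ℕ, |((A : ℝ) + 1) * Pr m (fun G => numIndep m k G = A + 1)
      - muk m k * Pr m (fun G => numIndep m k G = A)| ≤
      ∑ T ∈ Finset.powersetCard k (Finset.univ : Finset (Fin m)), pik k *
        Ex m (fun G => |ind (numIndep m k (dl T G) = A + 1) - ind (numIndep m k G = A)|) := by
    intro A
    rw [Pr_eq, Pr_eq, ← sum_const_pik, ← Ex_mul]
    have h2 : ∀ G : SimpleGraph (Fin m), ((A : ℝ) + 1) * ind (numIndep m k G = A + 1)
      = ∑ T ∈ Finset.powersetCard k (Finset.univ : Finset (Fin m)),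
        ind (IndepSet G T) * ind (numIndep m k G = A + 1) := by
      intro G
      rw [← Finset.sum_mul, ← numIndep_eq]
      unfold ind
      split_ifs with h
      · rw [h]; push_cast; ring
      · simp
    simp_rw [h2]
    rw [Ex_sum, ← Finset.sum_sub_distrib]
    refine (Finset.abs_sum_le_sum_abs _ _).trans ?_
    apply Finset.sum_le_sum
    intro T hT
    rw [Ex_indep_mul T (Finset.mem_powersetCard.1 hT).2 (fun G => ind (numIndep m k G = A + 1))]
    change |pik k * _ - _| ≤ _
    rw [← mul_sub, abs_mul, abs_of_pos (pik_pos k), ← Ex_sub]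
    exact mul_le_mul_of_nonneg_left (Ex_abs _) (pik_pos k).le
  refine (Finset.sum_le_sum fun A _ => h1 A).trans ?_
  rw [Finset.sum_comm]
  have : 2 * muk m k * (pik k + DD m k) = muk m k * (2 * (pik k + DD m k)) := by ring
  rw [this, ← sum_const_pik]
  apply Finset.sum_le_sum
  intro T hT
  rw [← Finset.mul_sum, ← Ex_sum]
  apply mul_le_mul_of_nonneg_left _ (pik_pos k).le
  refine (Ex_mono fun G => sum_abs_ind N _ _).trans ?_
  rw [Ex_mul]
  have := Ex_X_dl T (Finset.mem_powersetCard.1 hT).2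
  linarith

end Moments
section Numeric
open Classical

lemma q_pow (s : ℝ) (hs : 10 ≤ s) (j : ℕ) (hj : (j : ℝ) ≤ 5 * s) :
    Real.exp (-50) ≤ (1 - 5 / s) ^ j := by
  have hs0 : 0 < s := by linarith
  have hx : 5 / s ≤ 1 / 2 := by rw [div_le_iff₀ hs0]; linarith
  have hx0 : 0 < 5 / s := by positivity
  have h1 : Real.exp (-(10 / s)) ≤ 1 - 5 / s := by
    rw [Real.exp_neg, inv_le_comm₀ (Real.exp_pos _) (by linarith)]
    have h2 := Real.add_one_le_exp (10 / s)
    refine le_trans ?_ h2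
    rw [inv_le_iff_one_le_mul₀ (by linarith)]
    have : 10 / s = 2 * (5 / s) := by ring
    rw [this]
    nlinarith
  calc Real.exp (-50) ≤ Real.exp (-(10 / s) * j) := by
        apply Real.exp_le_exp.2
        have : 10 / s * j ≤ 50 := by
          rw [div_mul_eq_mul_div, div_le_iff₀ hs0]; linarith
        linarith
    _ = Real.exp (-(10 / s)) ^ j := by rw [mul_comm, Real.exp_nat_mul]
    _ ≤ _ := by gcongr

lemma step_bounds (x y a μ s : ℝ) (hx : 0 ≤ x) (hy : 0 ≤ y) (hμ : s ^ 2 = μ) (hs : 10 ≤ s)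
    (h1 : μ - 4 * s ≤ a) (h2 : a ≤ μ + 4 * s) :
    (1 - 5 / s) * x - 2 / μ * |(a + 1) * y - μ * x| ≤ y ∧
    (1 - 5 / s) * y - 2 / μ * |(a + 1) * y - μ * x| ≤ x := by
  have hs0 : 0 < s := by linarith
  have hμ0 : 0 < μ := by rw [← hμ]; positivity
  have ha : μ / 2 ≤ a + 1 := by nlinarith
  have ha0 : 0 < a + 1 := by linarith
  have e1 := neg_abs_le ((a + 1) * y - μ * x)
  have e2 := le_abs_self ((a + 1) * y - μ * x)
  set e := |(a + 1) * y - μ * x|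
  have he : 0 ≤ e := abs_nonneg _
  have hk : 5 / s * μ = 5 * s := by rw [← hμ]; field_simp
  constructor
  · have : (a + 1) * ((1 - 5 / s) * x - 2 / μ * e) ≤ (a + 1) * y := by
      have h3 : (a + 1) * (2 / μ * e) ≥ e := by
        have : (a + 1) * (2 / μ * e) = (a + 1) * 2 * e / μ := by ring
        rw [this, ge_iff_le, le_div_iff₀ hμ0]
        nlinarith
      have h4 : (a + 1) * (1 - 5 / s) ≤ μ := by
        have : 5 / s ≤ 1 := by rw [div_le_iff₀ hs0]; linarith
        have h5 : (a + 1) * (1 - 5 / s) ≤ (μ + 4 * s + 1) * (1 - 5 / s) := by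
          apply mul_le_mul_of_nonneg_right <;> linarith
        have h6 : 0 < 5 / s := by positivity
        nlinarith
      nlinarith [mul_le_mul_of_nonneg_right h4 hx]
    exact le_of_mul_le_mul_left this ha0
  · have : μ * ((1 - 5 / s) * y - 2 / μ * e) ≤ μ * x := by
      have h3 : μ * (2 / μ * e) = 2 * e := by field_simp
      have h4 : μ * (1 - 5 / s) ≤ a + 1 := by nlinarith
      nlinarith [mul_le_mul_of_nonneg_right h4 hy]
    exact le_of_mul_le_mul_left this hμ0

lemma local_lower (p : ℕ → ℝ) (hp : ∀ A, 0 ≤ p A) (μ s κ : ℝ) (hμ : s ^ 2 = μ) (hs : 10 ≤ s)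
    (N : ℕ) (hN : μ + 4 * s < N)
    (hmass : 1 / 2 ≤ ∑ A ∈ (Finset.range N).filter (fun A : ℕ => |(A : ℝ) - μ| < 2 * s), p A)
    (hst : ∑ A ∈ Finset.range N, |((A : ℝ) + 1) * p (A + 1) - μ * p A| ≤ 2 * μ * κ)
    (hκ : s * κ ≤ Real.exp (-50) / 80) (B : ℕ) (hB : |(B : ℝ) - μ| ≤ 3 * s) :
    Real.exp (-50) / 20 / s ≤ p B := by
  have hs0 : 0 < s := by linarith
  have hμ0 : 0 < μ := by rw [← hμ]; positivity
  -- a good point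
  have hcard : (((Finset.range N).filter (fun A : ℕ => |(A : ℝ) - μ| < 2 * s)).card : ℝ)
      ≤ 5 * s := by
    have hsub : (Finset.range N).filter (fun A : ℕ => |(A : ℝ) - μ| < 2 * s)
        ⊆ Finset.Icc ⌈μ - 2 * s⌉₊ ⌊μ + 2 * s⌋₊ := by
      intro A hA
      simp only [Finset.mem_filter, abs_lt] at hA
      rw [Finset.mem_Icc]
      constructor
      · apply Nat.ceil_le.2; linarith
      · apply Nat.le_floor; linarith
    have h1 := Finset.card_le_card hsub
    rw [Nat.card_Icc] at h1
    have h2 : (⌊μ + 2 * s⌋₊ : ℝ) ≤ μ + 2 * s := Nat.floor_le (by positivity)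
    have h3 : μ - 2 * s ≤ (⌈μ - 2 * s⌉₊ : ℝ) := Nat.le_ceil _
    by_cases hle : ⌈μ - 2 * s⌉₊ ≤ ⌊μ + 2 * s⌋₊ + 1
    · have h4 : (((Finset.range N).filter (fun A : ℕ => |(A : ℝ) - μ| < 2 * s)).card : ℝ)
        ≤ ((⌊μ + 2 * s⌋₊ + 1 - ⌈μ - 2 * s⌉₊ : ℕ) : ℝ) := by exact_mod_cast h1
      rw [Nat.cast_sub hle] at h4
      push_cast at h4
      linarith
    · have : ((Finset.range N).filter (fun A : ℕ => |(A : ℝ) - μ| < 2 * s)).card = 0 := by omega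
      rw [this]; simp; positivity
  obtain ⟨C, hC, hpC⟩ : ∃ C ∈ (Finset.range N).filter (fun A : ℕ => |(A : ℝ) - μ| < 2 * s),
      1 / (10 * s) ≤ p C := by
    by_contra hcon
    push Not at hcon
    have hne : ((Finset.range N).filter (fun A : ℕ => |(A : ℝ) - μ| < 2 * s)).Nonempty := by
      rw [Finset.nonempty_iff_ne_empty]
      intro h; rw [h] at hmass; norm_num at hmass
    have h1 := Finset.sum_lt_sum_of_nonempty hne hcon
    rw [Finset.sum_const, nsmul_eq_mul] at h1
    have h2 : (((Finset.range N).filter (fun A : ℕ => |(A : ℝ) - μ| < 2 * s)).card : ℝ)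
      * (1 / (10 * s)) ≤ 5 * s * (1 / (10 * s)) := by gcongr
    have h3 : 5 * s * (1 / (10 * s)) = 1 / 2 := by field_simp; norm_num
    linarith
  simp only [Finset.mem_filter, abs_lt] at hC
  rw [abs_le] at hB
  set e : ℕ → ℝ := fun A => |((A : ℝ) + 1) * p (A + 1) - μ * p A| with he
  have he0 : ∀ A, 0 ≤ e A := fun A => abs_nonneg _
  set q := 1 - 5 / s with hq
  have hq1 : q ≤ 1 := by
    have : 0 < 5 / s := by positivity
    linarith
  have hq0 : 0 ≤ q := by
    have : 5 / s ≤ 1 := by rw [div_le_iff₀ hs0]; linarith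
    linarith
  have hup : ∀ (D j : ℕ), μ - 4 * s ≤ D → (D : ℝ) + j ≤ μ + 4 * s →
      q ^ j * p D - 2 / μ * ∑ i ∈ Finset.Ico D (D + j), e i ≤ p (D + j) := by
    intro D j hD
    induction j with
    | zero => intro _; simp
    | succ j ih =>
      intro hj
      push_cast at hj
      have h1 := ih (by linarith)
      have h2 := (step_bounds (p (D + j)) (p (D + j + 1)) ((D + j : ℕ) : ℝ) μ s (hp _) (hp _) hμ hs
        (by push_cast; have : (0:ℝ) ≤ j := Nat.cast_nonneg j
            linarith) (by push_cast; linarith)).1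
      change q * p (D + j) - 2 / μ * e (D + j) ≤ _ at h2
      rw [← add_assoc, Finset.sum_Ico_succ_top (by omega)]
      have h3 : 0 ≤ 2 / μ * ∑ i ∈ Finset.Ico D (D + j), e i :=
        mul_nonneg (by positivity) (Finset.sum_nonneg fun i _ => he0 i)
      have h4 := mul_le_mul_of_nonneg_left h1 hq0
      rw [pow_succ]
      nlinarith
  have hdown : ∀ (D j : ℕ), μ - 4 * s ≤ D → (D : ℝ) + j ≤ μ + 4 * s →
      q ^ j * p (D + j) - 2 / μ * ∑ i ∈ Finset.Ico D (D + j), e i ≤ p D := by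
    intro D j hD
    induction j with
    | zero => intro _; simp
    | succ j ih =>
      intro hj
      push_cast at hj
      have h1 := ih (by linarith)
      have h2 := (step_bounds (p (D + j)) (p (D + j + 1)) ((D + j : ℕ) : ℝ) μ s (hp _) (hp _) hμ hs
        (by push_cast; have : (0:ℝ) ≤ j := Nat.cast_nonneg j
            linarith) (by push_cast; linarith)).2
      change q * p (D + j + 1) - 2 / μ * e (D + j) ≤ _ at h2
      rw [← add_assoc, Finset.sum_Ico_succ_top (by omega)]
      have h3 : 0 ≤ 2 / μ * e (D + j) := mul_nonneg (by positivity) (he0 _)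
      have h4 := mul_le_mul_of_nonneg_left h2 (pow_nonneg hq0 j)
      have h5 : q ^ j ≤ 1 := pow_le_one₀ hq0 hq1
      have h6 := mul_le_mul_of_nonneg_right h5 h3
      rw [pow_succ]
      nlinarith
  have hsum : ∀ D j : ℕ, (D : ℝ) + j ≤ μ + 4 * s →
      2 / μ * ∑ i ∈ Finset.Ico D (D + j), e i ≤ Real.exp (-50) / 20 / s := by
    intro D j hDj
    have h1 : ∑ i ∈ Finset.Ico D (D + j), e i ≤ 2 * μ * κ := by
      refine le_trans (Finset.sum_le_sum_of_subset_of_nonneg ?_ fun i _ _ => he0 i) hst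
      intro i hi
      rw [Finset.mem_Ico] at hi
      rw [Finset.mem_range]
      have : ((D + j : ℕ) : ℝ) < N := by push_cast; linarith
      have : D + j < N := by exact_mod_cast this
      omega
    calc _ ≤ 2 / μ * (2 * μ * κ) := by gcongr
      _ = 4 * κ := by field_simp; ring
      _ ≤ _ := by rw [le_div_iff₀ hs0]; linarith
  have hfin : ∀ j : ℕ, (j : ℝ) ≤ 5 * s → Real.exp (-50) / 10 / s ≤ q ^ j * p C := by
    intro j hj
    calc Real.exp (-50) / 10 / s = Real.exp (-50) * (1 / (10 * s)) := by field_simp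
      _ ≤ _ := mul_le_mul (q_pow s hs j hj) hpC (by positivity) (pow_nonneg hq0 j)
  have hhalf : Real.exp (-50) / 10 / s = Real.exp (-50) / 20 / s + Real.exp (-50) / 20 / s := by
    field_simp; norm_num
  rcases le_total C B with hCB | hCB
  · obtain ⟨j, rfl⟩ := Nat.exists_eq_add_of_le hCB
    push_cast at hB
    have h1 := hup C j (by linarith) (by linarith)
    have h2 := hsum C j (by linarith)
    have h3 := hfin j (by linarith)
    linarith
  · obtain ⟨j, rfl⟩ := Nat.exists_eq_add_of_le hCB
    push_cast at hC
    have h1 := hdown B j (by linarith) (by linarith)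
    have h2 := hsum B j (by linarith)
    have h3 := hfin j (by linarith)
    linarith

end Numeric
section Select
open Classical

lemma Pr_nonneg (m : ℕ) (B : SimpleGraph (Fin m) → Prop) : 0 ≤ Pr m B := by
  rw [Pr_eq]; exact Ex_nonneg fun G => ind_nonneg _

lemma Pr_mono {m : ℕ} {B C : SimpleGraph (Fin m) → Prop} (h : ∀ G, B G → C G) : Pr m B ≤ Pr m C := by
  rw [Pr_eq, Pr_eq]; exact Ex_mono fun G => ind_mono (h G)

lemma Pr_or {m : ℕ} {B C D : SimpleGraph (Fin m) → Prop} (h : ∀ G, B G → C G ∨ D G) :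
    Pr m B ≤ Pr m C + Pr m D := by
  rw [Pr_eq, Pr_eq, Pr_eq, ← Ex_add]
  apply Ex_mono
  intro G
  have := h G
  unfold ind
  split_ifs <;> first | tauto | norm_num

lemma graph_local (m k : ℕ) (s : ℝ) (hμ : s ^ 2 = muk m k) (hs : 10 ≤ s)
    (hD : s * (pik k + DD m k) ≤ Real.exp (-50) / 80) (B : ℕ)
    (hB : |(B : ℝ) - muk m k| ≤ 3 * s) :
    Real.exp (-50) / 20 / s ≤ Pr m (fun G => numIndep m k G = B) := by
  have hs0 : 0 < s := by linarith
  have hμ0 : 0 < muk m k := by rw [← hμ]; positivity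
  obtain ⟨N, hN⟩ := exists_nat_gt (muk m k + 4 * s)
  refine local_lower (fun A => Pr m (fun G => numIndep m k G = A)) (fun A => Pr_nonneg _ _)
    (muk m k) s (pik k + DD m k) hμ hs N hN ?_ (stein m k N) hD B hB
  have hD1 : DD m k ≤ 1 := by
    have h1 := pik_pos k
    have h2 := DD_nonneg m k
    have h3 : Real.exp (-50) ≤ 1 := Real.exp_le_one_iff.2 (by norm_num)
    nlinarith
  simp_rw [Pr_eq]
  rw [← Ex_sum]
  have hpt : ∀ G : SimpleGraph (Fin m),
      1 - (1 / (4 * muk m k)) * ((numIndep m k G : ℝ) - muk m k) ^ 2 ≤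
      ∑ A ∈ (Finset.range N).filter (fun A : ℕ => |(A : ℝ) - muk m k| < 2 * s),
        ind (numIndep m k G = A) := by
    intro G
    by_cases h : |(numIndep m k G : ℝ) - muk m k| < 2 * s
    · have hm : numIndep m k G ∈
          (Finset.range N).filter (fun A : ℕ => |(A : ℝ) - muk m k| < 2 * s) := by
        rw [Finset.mem_filter, Finset.mem_range]
        refine ⟨?_, h⟩
        rw [abs_lt] at h
        have : (numIndep m k G : ℝ) < N := by linarith
        exact_mod_cast this
      have h1 := Finset.single_le_sum (f := fun A => ind (numIndep m k G = A))
        (fun A _ => ind_nonneg _) hm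
      have h2 : ind (numIndep m k G = numIndep m k G) = 1 := by simp [ind]
      have h1' := h2.symm.le.trans h1
      have : 0 ≤ (1 / (4 * muk m k)) * ((numIndep m k G : ℝ) - muk m k) ^ 2 := by positivity
      linarith
    · push Not at h
      have h1 : (2 * s) ^ 2 ≤ ((numIndep m k G : ℝ) - muk m k) ^ 2 := by
        rw [← sq_abs ((numIndep m k G : ℝ) - muk m k)]
        gcongr
      have h2 : 1 ≤ (1 / (4 * muk m k)) * ((numIndep m k G : ℝ) - muk m k) ^ 2 := by
        rw [one_div_mul_eq_div, le_div_iff₀ (by positivity)]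
        nlinarith
      have := Finset.sum_nonneg (s := (Finset.range N).filter
        (fun A : ℕ => |(A : ℝ) - muk m k| < 2 * s))
        (f := fun A => ind (numIndep m k G = A)) (fun A _ => ind_nonneg _)
      linarith
  refine le_trans ?_ (Ex_mono hpt)
  rw [Ex_sub, Ex_const, Ex_mul]
  have hv := var_X m k
  have : 1 / (4 * muk m k) * Ex m (fun G => ((numIndep m k G : ℝ) - muk m k) ^ 2) ≤
     1 / (4 * muk m k) * (muk m k * (1 + DD m k)) := by gcongr
  have h2 : 1 / (4 * muk m k) * (muk m k * (1 + DD m k)) = (1 + DD m k) / 4 := by field_simp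
  linarith

lemma cond_good (m k A : ℕ) (B : SimpleGraph (Fin m) → Prop)
    (h : 8 * Pr m (fun G => numIndep m k G = A ∧ ¬ (AllDisjoint m k G ∧ B G))
      < Pr m (fun G => numIndep m k G = A)) :
    condPr m B (fun G => numIndep m k G = A ∧ AllDisjoint m k G) > 3 / 4 := by
  rw [condPr_eq]
  have h0 := Pr_nonneg m (fun G => numIndep m k G = A ∧ ¬ (AllDisjoint m k G ∧ B G))
  have h1 : Pr m (fun G => numIndep m k G = A) ≤
    Pr m (fun G => (numIndep m k G = A ∧ AllDisjoint m k G) ∧ B G) +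
    Pr m (fun G => numIndep m k G = A ∧ ¬ (AllDisjoint m k G ∧ B G)) := Pr_or (fun G hG => by tauto)
  have h2 : Pr m (fun G => numIndep m k G = A ∧ AllDisjoint m k G) ≤
    Pr m (fun G => numIndep m k G = A) := Pr_mono fun G hG => hG.1
  have h3 : Pr m (fun G => (numIndep m k G = A ∧ AllDisjoint m k G) ∧ B G) ≤
    Pr m (fun G => numIndep m k G = A ∧ AllDisjoint m k G) := Pr_mono fun G hG => hG.1
  rw [gt_iff_lt, lt_div_iff₀ (by linarith)]
  linarith

lemma sum_bad (m k r A0 : ℕ) (B : SimpleGraph (Fin m) → Prop) :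
    ∑ i ∈ Finset.range r, Pr m (fun G => numIndep m k G = A0 + i ∧ ¬ (AllDisjoint m k G ∧ B G))
    ≤ Pr m (fun G => ¬ B G) + muk m k * DD m k := by
  have h : Pr m (fun G => ¬ (AllDisjoint m k G ∧ B G)) ≤
     Pr m (fun G => ¬ B G) + Pr m (fun G => ¬ AllDisjoint m k G) := Pr_or (fun G hG => by tauto)
  have h2 := Pr_notdisj m k
  refine le_trans ?_ (h.trans (by linarith))
  simp_rw [Pr_eq]
  rw [← Ex_sum]
  apply Ex_mono
  intro G
  by_cases hG : ¬ (AllDisjoint m k G ∧ B G)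
  · rw [ind.eq_1 (¬ (AllDisjoint m k G ∧ B G)), if_pos hG]
    exact sum_ind_le_one r _ (fun x y hx hy => by omega)
  · rw [Finset.sum_eq_zero]
    · exact ind_nonneg _
    · intro i _
      rw [ind, if_neg (by tauto)]

lemma select (n n' k r : ℕ) (s : ℝ) (B : SimpleGraph (Fin n) → Prop)
    (B' : SimpleGraph (Fin n') → Prop) (hμ : s ^ 2 = muk n k) (hs : 10 ≤ s)
    (hr : r = ⌊s⌋₊) (h1 : muk n k ≤ muk n' k) (h2 : muk n' k ≤ muk n k + s)
    (hD : s * (pik k + DD n k) ≤ Real.exp (-50) / 80)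
    (hD' : 2 * s * (pik k + DD n' k) ≤ Real.exp (-50) / 80)
    (hη : Pr n (fun G => ¬ B G) + muk n k * DD n k + (Pr n' (fun G => ¬ B' G) + muk n' k * DD n' k)
      < Real.exp (-50) / 640) :
    ∃ A : ℕ, muk n k ≤ A ∧ (A : ℝ) ≤ muk n k + s ∧
      condPr n B (fun G => numIndep n k G = A ∧ AllDisjoint n k G) > 3 / 4 ∧
      condPr n' B' (fun G => numIndep n' k G = A + r ∧ AllDisjoint n' k G) > 3 / 4 := by
  have hs0 : 0 < s := by linarith
  have hμ0 : 0 < muk n k := by rw [← hμ]; positivity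
  set A0 := ⌈muk n k⌉₊ with hA0
  have hA1 : muk n k ≤ A0 := Nat.le_ceil _
  have hA2 : (A0 : ℝ) < muk n k + 1 := Nat.ceil_lt_add_one hμ0.le
  have hr1 : (r : ℝ) ≤ s := by rw [hr]; exact Nat.floor_le hs0.le
  have hr2 : s < r + 1 := by rw [hr]; exact Nat.lt_floor_add_one s
  set s' := Real.sqrt (muk n' k) with hs'
  have hμ' : s' ^ 2 = muk n' k := Real.sq_sqrt (by linarith)
  have hss : s ≤ s' := by rw [hs']; apply Real.le_sqrt_of_sq_le; linarith
  have hss2 : s' ≤ 2 * s := by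
    rw [hs']; apply Real.sqrt_le_iff.2; constructor
    · linarith
    · nlinarith
  have hloc : ∀ i ∈ Finset.range r, Real.exp (-50) / 20 / (2 * s) ≤
      Pr n (fun G => numIndep n k G = A0 + i) := by
    intro i hi
    have hi' : (i : ℝ) + 1 ≤ r := by exact_mod_cast Finset.mem_range.1 hi
    have hi0 : (0 : ℝ) ≤ i := Nat.cast_nonneg i
    refine le_trans ?_ (graph_local n k s hμ hs hD (A0 + i) ?_)
    · gcongr; linarith
    · push_cast; rw [abs_le]; constructor <;> linarith
  have hloc' : ∀ i ∈ Finset.range r, Real.exp (-50) / 20 / (2 * s) ≤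
      Pr n' (fun G => numIndep n' k G = A0 + r + i) := by
    intro i hi
    have hi' : (i : ℝ) + 1 ≤ r := by exact_mod_cast Finset.mem_range.1 hi
    have hi0 : (0 : ℝ) ≤ i := Nat.cast_nonneg i
    refine le_trans ?_ (graph_local n' k s' hμ' (by linarith) ?_ (A0 + r + i) ?_)
    · have : 0 < s' := by linarith
      gcongr
    · refine le_trans ?_ hD'
      have := pik_pos k
      have := DD_nonneg n' k
      gcongr
    · push_cast; rw [abs_le]; constructor <;> linarith
  by_contra hcon
  push Not at hcon
  have hbad : ∀ i ∈ Finset.range r, Real.exp (-50) / 20 / (2 * s) / 8 ≤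
      Pr n (fun G => numIndep n k G = A0 + i ∧ ¬ (AllDisjoint n k G ∧ B G)) +
      Pr n' (fun G => numIndep n' k G = A0 + r + i ∧ ¬ (AllDisjoint n' k G ∧ B' G)) := by
    intro i hi
    have hi' : (i : ℝ) + 1 ≤ r := by exact_mod_cast Finset.mem_range.1 hi
    have hi0 : (0 : ℝ) ≤ i := Nat.cast_nonneg i
    have p1 := Pr_nonneg n (fun G => numIndep n k G = A0 + i ∧ ¬ (AllDisjoint n k G ∧ B G))
    have p2 := Pr_nonneg n'
      (fun G => numIndep n' k G = A0 + r + i ∧ ¬ (AllDisjoint n' k G ∧ B' G))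
    by_contra hlt
    rw [not_le] at hlt
    have l1 := hloc i hi
    have l2 := hloc' i hi
    have c1 := cond_good n k (A0 + i) B (by linarith)
    have c2 := cond_good n' k (A0 + r + i) B' (by linarith)
    have := hcon (A0 + i) (by push_cast; linarith) (by push_cast; linarith) c1
    rw [show A0 + i + r = A0 + r + i by ring] at this
    linarith
  have hsum := Finset.sum_le_sum hbad
  rw [Finset.sum_const, Finset.card_range, nsmul_eq_mul, Finset.sum_add_distrib] at hsum
  have b1 := sum_bad n k r A0 B
  have b2 := sum_bad n' k r (A0 + r) B'
  have h3 : Real.exp (-50) / 640 ≤ r * (Real.exp (-50) / 20 / (2 * s) / 8) := by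
    have : r * (Real.exp (-50) / 20 / (2 * s) / 8) = (r * Real.exp (-50) / 320) / s := by
      field_simp; ring
    rw [this, le_div_iff₀ hs0]
    have := Real.exp_pos (-50)
    nlinarith
  linarith

end Select
section Analytic

lemma my_sq_le {a b : ℝ} (h : a ^ 2 ≤ b ^ 2) (hb : 0 ≤ b) : a ≤ b := by
  by_contra hc
  nlinarith

lemma choose_ratio (m k l : ℕ) (hl : l ≤ k) (hk : k ≤ m) :
    (m.choose (k - l) : ℝ) * ((m : ℝ) - k) ^ l ≤ (m.choose k : ℝ) * (k : ℝ) ^ l := by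
  have hmk : (0 : ℝ) ≤ (m : ℝ) - k := by
    have : (k : ℝ) ≤ m := by exact_mod_cast hk
    linarith
  induction l with
  | zero => simp
  | succ l ih =>
    have ih := ih (by omega)
    obtain ⟨j, hj⟩ : ∃ j, k - l = j + 1 := ⟨k - l - 1, by omega⟩
    have hj' : k - (l + 1) = j := by omega
    rw [hj'] ; rw [hj] at ih
    have hs := Nat.choose_succ_right_eq m j
    have hs' : (m.choose (j + 1) : ℝ) * ((j : ℝ) + 1) = (m.choose j : ℝ) * ((m : ℝ) - j) := by
      rw [← Nat.cast_sub (by omega)]; exact_mod_cast hs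
    have hjk : (j : ℝ) + 1 ≤ k := by
      have : j + 1 ≤ k := by omega
      exact_mod_cast this
    have h1 : (m.choose j : ℝ) * ((m : ℝ) - k) ≤ (m.choose (j + 1) : ℝ) * k := by
      calc (m.choose j : ℝ) * ((m : ℝ) - k) ≤ (m.choose j : ℝ) * ((m : ℝ) - j) := by
            apply mul_le_mul_of_nonneg_left _ (Nat.cast_nonneg _); linarith
        _ = (m.choose (j + 1) : ℝ) * ((j : ℝ) + 1) := hs'.symm
        _ ≤ _ := by gcongr
    calc (m.choose j : ℝ) * ((m : ℝ) - k) ^ (l + 1)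
        = ((m.choose j : ℝ) * ((m : ℝ) - k)) * ((m : ℝ) - k) ^ l := by ring
      _ ≤ ((m.choose (j + 1) : ℝ) * k) * ((m : ℝ) - k) ^ l := by gcongr
      _ = ((m.choose (j + 1) : ℝ) * ((m : ℝ) - k) ^ l) * k := by ring
      _ ≤ ((m.choose k : ℝ) * (k : ℝ) ^ l) * k := by gcongr
      _ = _ := by ring

lemma choose_shift (n d k : ℕ) (y : ℝ) (hkn : k ≤ n)
    (hy : ∀ i < k, (n : ℝ) + d - i ≤ y * ((n : ℝ) - i)) :
    ((n + d).choose k : ℝ) ≤ y ^ k * (n.choose k : ℝ) := by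
  induction k with
  | zero => simp
  | succ j ih =>
    have ih := ih (by omega) (fun i hi => hy i (by omega))
    have h1 := Nat.choose_succ_right_eq (n + d) j
    have h2 := Nat.choose_succ_right_eq n j
    have h1' : ((n + d).choose (j + 1) : ℝ) * ((j : ℝ) + 1) =
        ((n + d).choose j : ℝ) * ((n : ℝ) + d - j) := by
      rw [← Nat.cast_add, ← Nat.cast_sub (by omega)]; exact_mod_cast h1
    have h2' : (n.choose (j + 1) : ℝ) * ((j : ℝ) + 1) = (n.choose j : ℝ) * ((n : ℝ) - j) := by
      rw [← Nat.cast_sub (by omega)]; exact_mod_cast h2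
    have hyj := hy j (by omega)
    have hjn : (j : ℝ) + 1 ≤ n := by exact_mod_cast hkn
    have hd : (0 : ℝ) ≤ d := Nat.cast_nonneg d
    have key : ((n + d).choose (j + 1) : ℝ) * ((j : ℝ) + 1) ≤
        (y ^ (j + 1) * (n.choose (j + 1) : ℝ)) * ((j : ℝ) + 1) := by
      calc _ = ((n + d).choose j : ℝ) * ((n : ℝ) + d - j) := h1'
        _ ≤ (y ^ j * (n.choose j : ℝ)) * ((n : ℝ) + d - j) := by
            gcongr
            linarith
        _ ≤ (y ^ j * (n.choose j : ℝ)) * (y * ((n : ℝ) - j)) := by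
            apply mul_le_mul_of_nonneg_left hyj
            exact le_trans (Nat.cast_nonneg _) ih
        _ = y ^ (j + 1) * ((n.choose j : ℝ) * ((n : ℝ) - j)) := by ring
        _ = _ := by rw [← h2']; ring
    exact le_of_mul_le_mul_right key (by positivity)

lemma two_choose (l : ℕ) : 2 * l.choose 2 = l * (l - 1) := by
  rw [Nat.choose_two_right, Nat.mul_div_cancel' (Nat.even_mul_pred_self l).two_dvd]

lemma pow_le_aux (b w : ℝ) (l : ℕ) (hl : 2 ≤ l) (hb : 0 ≤ b) (hbw : b ≤ w) (hw : w ≤ 1) :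
    b ^ l ≤ w ^ 2 := by
  calc b ^ l ≤ w ^ l := by gcongr
    _ ≤ w ^ 2 := pow_le_pow_of_le_one (hb.trans hbw) hw hl

lemma term_small (k l : ℕ) (n L u : ℝ) (hn : 0 < n) (hL : 1 ≤ L) (hl : 1 ≤ l) (h2l : 2 * l ≤ k)
    (h2b : (2 : ℝ) ^ k ≤ n ^ 2) (hu0 : 0 ≤ u) (hu : u ≤ 8 * L ^ 2 / n) (hbig : 64 * L ^ 5 ≤ n) :
    u ^ l * 2 ^ (l.choose 2) ≤ 64 * L ^ 5 / n := by
  have hL0 : 0 < L := by linarith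
  have hL45 : L ^ 4 ≤ L ^ 5 := pow_le_pow_right₀ hL (by norm_num)
  have hL25 : L ^ 2 ≤ L ^ 5 := pow_le_pow_right₀ hL (by norm_num)
  rcases hl.lt_or_eq with h | h
  · apply my_sq_le ?_ (by positivity)
    have e1 : (u ^ l * 2 ^ (l.choose 2)) ^ 2 = (u ^ 2 * 2 ^ (l - 1)) ^ l := by
      rw [mul_pow, mul_pow, ← pow_mul, ← pow_mul, ← pow_mul, ← pow_mul, mul_comm (l.choose 2) 2,
        two_choose, mul_comm l 2, mul_comm l (l - 1)]
    rw [e1]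
    apply pow_le_aux _ _ _ h (by positivity)
    · have h1 : (2 : ℝ) ^ l ≤ n := by
        apply my_sq_le ?_ hn.le
        rw [← pow_mul]
        refine le_trans ?_ h2b
        exact pow_le_pow_right₀ (by norm_num) (by omega)
      have h2 : (2 : ℝ) ^ (l - 1) ≤ n := le_trans (pow_le_pow_right₀ (by norm_num) (by omega)) h1
      calc u ^ 2 * 2 ^ (l - 1) ≤ (8 * L ^ 2 / n) ^ 2 * n := by gcongr
        _ = 64 * L ^ 4 / n := by field_simp; norm_num
        _ ≤ _ := by gcongr
    · rw [div_le_one hn]; exact hbig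
  · rw [← h]
    simp
    refine hu.trans ?_
    gcongr
    norm_num

lemma term_large (k l j : ℕ) (n L : ℝ) (hn : 0 < n) (hL : 1 ≤ L) (hj : 1 ≤ j) (h2j : 2 * j ≤ k)
    (hlj : l + j = k)
    (h2a : (n / L) ^ 2 ≤ (2 : ℝ) ^ k) (hbig : 64 * L ^ 5 ≤ n) :
    (4 * L * n) ^ j * ((2 : ℝ)⁻¹ ^ (k.choose 2) * 2 ^ (l.choose 2)) ≤ 64 * L ^ 5 / n := by
  have hL0 : 0 < L := by linarith
  have hL35 : L ^ 3 ≤ L ^ 5 := pow_le_pow_right₀ hL (by norm_num)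
  have hexp : 2 * k.choose 2 = 2 * l.choose 2 + (2 * k - j - 1) * j := by
    rw [two_choose, two_choose]
    obtain ⟨a, rfl⟩ : ∃ a, j = a + 1 := ⟨j - 1, by omega⟩
    obtain ⟨b, rfl⟩ : ∃ b, l = b + 1 := ⟨l - 1, by omega⟩
    subst hlj
    have e1 : b + 1 + (a + 1) - 1 = b + a + 1 := by omega
    have e2 : 2 * (b + 1 + (a + 1)) - (a + 1) - 1 = 2 * b + a + 2 := by omega
    rw [e1, e2, Nat.add_sub_cancel]
    ring
  have e1 : ((4 * L * n) ^ j * ((2 : ℝ)⁻¹ ^ (k.choose 2) * 2 ^ (l.choose 2))) ^ 2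
      = ((4 * L * n) ^ 2 * (2 : ℝ)⁻¹ ^ (2 * k - j - 1)) ^ j := by
    generalize 4 * L * n = z
    rw [mul_pow, mul_pow, mul_pow _ _ j, ← pow_mul, ← pow_mul, ← pow_mul, ← pow_mul, ← pow_mul,
      mul_comm (k.choose 2) 2, mul_comm (l.choose 2) 2, hexp, pow_add, mul_comm j 2]
    have : (2 : ℝ)⁻¹ ^ (2 * l.choose 2) * 2 ^ (2 * l.choose 2) = 1 := by
      rw [← mul_pow]; norm_num
    linear_combination (z ^ (2 * j) * 2⁻¹ ^ ((2 * k - j - 1) * j)) * this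
  apply my_sq_le ?_ (by positivity)
  rw [e1]
  rcases hj.lt_or_eq with h | h
  · apply pow_le_aux _ _ _ h (by positivity)
    · have h1 : (n / L) ^ 3 ≤ (2 : ℝ) ^ (2 * k - j) := by
        apply my_sq_le ?_ (by positivity)
        calc ((n / L) ^ 3) ^ 2 = ((n / L) ^ 2) ^ 3 := by ring
          _ ≤ ((2 : ℝ) ^ k) ^ 3 := by gcongr
          _ = (2 : ℝ) ^ (k * 3) := by rw [← pow_mul]
          _ ≤ (2 : ℝ) ^ ((2 * k - j) * 2) := pow_le_pow_right₀ (by norm_num) (by omega)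
          _ = _ := by rw [← pow_mul]
      have h2 : (2 : ℝ)⁻¹ ^ (2 * k - j - 1) ≤ 2 * ((n / L) ^ 3)⁻¹ := by
        have h3 : (2 : ℝ)⁻¹ ^ (2 * k - j - 1) = 2 * ((2 : ℝ) ^ (2 * k - j))⁻¹ := by
          obtain ⟨a, ha⟩ : ∃ a, 2 * k - j = a + 1 := ⟨2 * k - j - 1, by omega⟩
          rw [ha, Nat.add_sub_cancel, pow_succ, inv_pow, mul_inv]
          field_simp
        rw [h3]
        gcongr
      calc (4 * L * n) ^ 2 * (2 : ℝ)⁻¹ ^ (2 * k - j - 1)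
          ≤ (4 * L * n) ^ 2 * (2 * ((n / L) ^ 3)⁻¹) := by gcongr
        _ = 32 * L ^ 5 / n := by field_simp; norm_num
        _ ≤ _ := by gcongr; norm_num
    · rw [div_le_one hn]; exact hbig
  · subst h
    have h3 : (2 : ℝ)⁻¹ ^ (2 * k - 1 - 1) = 4 * (((2 : ℝ) ^ k) ^ 2)⁻¹ := by
      obtain ⟨a, ha⟩ : ∃ a, k = a + 1 := ⟨k - 1, by omega⟩
      have : 2 * k - 1 - 1 = a * 2 := by omega
      rw [this, ha, pow_mul, pow_succ, inv_pow]
      field_simp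
      ring
    rw [h3, pow_one]
    calc (4 * L * n) ^ 2 * (4 * (((2 : ℝ) ^ k) ^ 2)⁻¹)
        ≤ (4 * L * n) ^ 2 * (4 * (((n / L) ^ 2) ^ 2)⁻¹) := by gcongr
      _ = (8 * L ^ 3 / n) ^ 2 := by field_simp; norm_num
      _ ≤ _ := by gcongr; norm_num

lemma DD_bound (m n k : ℕ) (L : ℝ) (hL : 1 ≤ L) (hn : 0 < n) (hk : (k : ℝ) ≤ 2 * L)
    (h2a : ((n : ℝ) / L) ^ 2 ≤ (2 : ℝ) ^ k) (h2b : (2 : ℝ) ^ k ≤ (n : ℝ) ^ 2) (hnm : n ≤ m)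
    (hm : m ≤ 2 * n) (h2k : 2 * k ≤ n) (hbig : 64 * L ^ 5 ≤ n) :
    DD m k ≤ 128 * L ^ 6 * (1 + muk m k) / n := by
  have hL0 : 0 < L := by linarith
  have hn0 : (0 : ℝ) < n := by exact_mod_cast hn
  have hM := muk_nonneg m k
  have hnm' : (n : ℝ) ≤ m := by exact_mod_cast hnm
  have hm' : (m : ℝ) ≤ 2 * n := by exact_mod_cast hm
  have h2k' : 2 * (k : ℝ) ≤ n := by exact_mod_cast h2k
  have hW : 0 ≤ 64 * L ^ 5 / n := by positivity
  have hterm : ∀ l ∈ Finset.Ico 1 k, (k.choose l : ℝ) * (m.choose (k - l) : ℝ) *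
    ((2 : ℝ)⁻¹ ^ (k.choose 2) * 2 ^ (l.choose 2)) ≤ (1 + muk m k) * (64 * L ^ 5 / n) := by
    intro l hl
    rw [Finset.mem_Ico] at hl
    by_cases hc : 2 * l ≤ k
    · have hmk : 0 < (m : ℝ) - k := by linarith
      set u := (k : ℝ) * k / ((m : ℝ) - k) with hu
      have hu8 : u ≤ 8 * L ^ 2 / n := by
        rw [hu, div_le_div_iff₀ hmk hn0]
        have h1 : (k : ℝ) * k ≤ (2 * L) * (2 * L) := by gcongr
        have h2 : (n : ℝ) ≤ 2 * ((m : ℝ) - k) := by linarith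
        calc (k : ℝ) * k * n ≤ ((2 * L) * (2 * L)) * (2 * ((m : ℝ) - k)) := by gcongr
          _ = _ := by ring
      have h1 := term_small k l n L u hn0 hL hl.1 hc h2b (by positivity) hu8 hbig
      have h2 := choose_ratio m k l hl.2.le (by omega)
      have h3 : (m.choose (k - l) : ℝ) ≤ (m.choose k : ℝ) * ((k : ℝ) / ((m : ℝ) - k)) ^ l := by
        rw [div_pow, mul_div_assoc', le_div_iff₀ (by positivity)]; exact h2
      have h4 : (k.choose l : ℝ) ≤ (k : ℝ) ^ l := by exact_mod_cast Nat.choose_le_pow k l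
      calc _ ≤ (k : ℝ) ^ l * ((m.choose k : ℝ) * ((k : ℝ) / ((m : ℝ) - k)) ^ l) *
            ((2 : ℝ)⁻¹ ^ (k.choose 2) * 2 ^ (l.choose 2)) := by gcongr
        _ = muk m k * (u ^ l * 2 ^ (l.choose 2)) := by
            rw [hu, mul_div_assoc, mul_pow]; unfold muk; ring
        _ ≤ muk m k * (64 * L ^ 5 / n) := by gcongr
        _ ≤ _ := by gcongr; linarith
    · have h1 := term_large k l (k - l) n L hn0 hL (by omega) (by omega) (by omega) h2a hbig
      have h4 : (k.choose l : ℝ) ≤ (2 * L) ^ (k - l) := by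
        rw [← Nat.choose_symm hl.2.le]
        calc (k.choose (k - l) : ℝ) ≤ (k : ℝ) ^ (k - l) := by
              exact_mod_cast Nat.choose_le_pow k (k - l)
          _ ≤ _ := by gcongr
      have h5 : (m.choose (k - l) : ℝ) ≤ (2 * n) ^ (k - l) := by
        calc (m.choose (k - l) : ℝ) ≤ (m : ℝ) ^ (k - l) := by
              exact_mod_cast Nat.choose_le_pow m (k - l)
          _ ≤ _ := by gcongr
      calc _ ≤ (2 * L) ^ (k - l) * (2 * n) ^ (k - l) *
            ((2 : ℝ)⁻¹ ^ (k.choose 2) * 2 ^ (l.choose 2)) := by gcongr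
        _ = (4 * L * n) ^ (k - l) * ((2 : ℝ)⁻¹ ^ (k.choose 2) * 2 ^ (l.choose 2)) := by
            rw [← mul_pow]; ring_nf
        _ ≤ 64 * L ^ 5 / n := h1
        _ ≤ _ := by nlinarith
  unfold DD
  refine (Finset.sum_le_sum hterm).trans ?_
  rw [Finset.sum_const, Nat.card_Ico, nsmul_eq_mul]
  have : ((k - 1 : ℕ) : ℝ) ≤ 2 * L := by
    refine le_trans ?_ hk
    exact_mod_cast Nat.sub_le k 1
  calc _ ≤ (2 * L) * ((1 + muk m k) * (64 * L ^ 5 / n)) := by gcongr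
    _ = _ := by ring

end Analytic
section Final

lemma muk_shift (n r k : ℕ) (M s : ℝ) (hM : M = muk n k) (hs : s ^ 2 = M) (hs0 : 0 < s)
    (hn : 0 < n) (h2k : 2 * k ≤ n) (hr : (r : ℝ) ≤ s)
    (hb : 4 * (k : ℝ) ^ 2 * M ≤ n) (hb1 : 2 * (k : ℝ) ^ 2 * s ≤ n) :
    muk n k ≤ muk (n + r * k) k ∧ muk (n + r * k) k ≤ muk n k + s := by
  have hn0 : (0 : ℝ) < n := by exact_mod_cast hn
  constructor
  · unfold muk
    gcongr
    omega
  · have h2k' : 2 * (k : ℝ) ≤ n := by exact_mod_cast h2k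
    have h1 := choose_shift n (r * k) k (1 + 2 * (r * k) / n) (by omega) (by
      intro i hi
      have hi' : (i : ℝ) ≤ k := by exact_mod_cast hi.le
      push_cast
      have : (r : ℝ) * k ≤ 2 * (r * k) / n * ((n : ℝ) - i) := by
        rw [div_mul_eq_mul_div, le_div_iff₀ hn0]
        have h0 : (0 : ℝ) ≤ r * k := by positivity
        nlinarith
      linarith)
    set x : ℝ := 2 * (r * k) / n with hx
    have hx0 : 0 ≤ x := by positivity
    have hkx : k * x = 2 * k ^ 2 * r / n := by rw [hx]; ring
    have hkx1 : k * x ≤ 1 := by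
      rw [hkx, div_le_one hn0]
      refine le_trans ?_ hb1
      gcongr
    have h2 : (1 + x) ^ k ≤ 1 + 2 * (k * x) := by
      have e1 : (1 + x) ^ k ≤ Real.exp (k * x) := by
        rw [Real.exp_nat_mul]
        have := Real.add_one_le_exp x
        gcongr
        linarith
      have hkx0 : 0 ≤ k * x := by positivity
      have e2 := Real.abs_exp_sub_one_le (x := k * x) (by rw [abs_of_nonneg hkx0]; exact hkx1)
      rw [abs_of_nonneg hkx0] at e2
      have e3 := le_abs_self (Real.exp (k * x) - 1)
      linarith
    have h3 : muk (n + r * k) k ≤ (1 + x) ^ k * muk n k := by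
      unfold muk
      rw [← mul_assoc]
      gcongr
    have hM0 : 0 < M := by rw [← hs]; positivity
    have h4 : 2 * (k * x) * M ≤ s := by
      rw [hkx]
      have : 2 * (2 * (k : ℝ) ^ 2 * r / n) * M = (4 * (k : ℝ) ^ 2 * M * r) / n := by ring
      rw [this, div_le_iff₀ hn0]
      calc 4 * (k : ℝ) ^ 2 * M * r ≤ n * s := by gcongr
        _ = s * n := by ring
    rw [← hM] at h3 ⊢
    calc _ ≤ (1 + x) ^ k * M := h3
      _ ≤ (1 + 2 * (k * x)) * M := by gcongr
      _ ≤ _ := by linarith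

set_option maxHeartbeats 2000000 in
lemma final_bounds (n k r : ℕ) (L M s τ : ℝ) (hM : M = muk n k) (hs : s ^ 2 = M) (hs10 : 10 ≤ s)
    (hr : r = ⌊s⌋₊) (hL : 3 ≤ L) (hk : (k : ℝ) ≤ 2 * L)
    (h2a : ((n : ℝ) / L) ^ 2 ≤ (2 : ℝ) ^ k) (h2b : (2 : ℝ) ^ k ≤ (n : ℝ) ^ 2)
    (hτ0 : 0 < τ) (hτ : τ ≤ 1 / 1000000) (hn : 0 < n) (hmain : L ^ 6 * M ^ 2 ≤ τ * n) :
    muk n k ≤ muk (n + r * k) k ∧ muk (n + r * k) k ≤ muk n k + s ∧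
    s * (pik k + DD n k) ≤ 2000 * τ ∧ 2 * s * (pik k + DD (n + r * k) k) ≤ 2000 * τ ∧
    muk n k * DD n k ≤ 2000 * τ ∧ muk (n + r * k) k * DD (n + r * k) k ≤ 2000 * τ := by
  have hn0 : (0 : ℝ) < n := by exact_mod_cast hn
  have hs0 : 0 < s := by linarith
  have hM100 : 100 ≤ M := by nlinarith
  have hsM : s ≤ M := by nlinarith
  have hr1 : (r : ℝ) ≤ s := by rw [hr]; exact Nat.floor_le hs0.le
  have hsmall : 1000000 * (L ^ 6 * M ^ 2) ≤ n := by nlinarith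
  have hL0 : 0 < L := by linarith
  have hL1 : 1 ≤ L := by linarith
  have pL : ∀ i j : ℕ, i ≤ 6 → j ≤ 2 → L ^ i * M ^ j ≤ L ^ 6 * M ^ 2 := by
    intro i j hi hj
    have h1 : L ^ i ≤ L ^ 6 := pow_le_pow_right₀ hL1 hi
    have h2 : M ^ j ≤ M ^ 2 := pow_le_pow_right₀ (by linarith) hj
    gcongr
  have pL10 := pL 1 0 (by norm_num) (by norm_num)
  have pL50 := pL 5 0 (by norm_num) (by norm_num)
  have pL11 := pL 1 1 (by norm_num) (by norm_num)
  have pL21 := pL 2 1 (by norm_num) (by norm_num)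
  have pL22 := pL 2 1 (by norm_num) (by norm_num)
  simp only [pow_one, pow_zero, mul_one] at pL10 pL50 pL11 pL21 pL22
  have hLM : 0 < L ^ 6 * M ^ 2 := by positivity
  have h2k' : 2 * (k : ℝ) ≤ n := by linarith
  have h2k : 2 * k ≤ n := by exact_mod_cast h2k'
  have hk0 : (0 : ℝ) ≤ k := Nat.cast_nonneg k
  have hk2 : (k : ℝ) ^ 2 ≤ 4 * L ^ 2 := by nlinarith
  have hk2M : (k : ℝ) ^ 2 * M ≤ 4 * L ^ 2 * M := by gcongr
  have hk2s : (k : ℝ) ^ 2 * s ≤ 4 * L ^ 2 * M := by gcongr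
  obtain ⟨g1, g2⟩ := muk_shift n r k M s hM hs hs0 hn h2k hr1 (by linarith) (by linarith)
  have hrk : (r : ℝ) * k ≤ n := by
    calc (r : ℝ) * k ≤ M * (2 * L) := by gcongr; linarith
      _ = 2 * (L * M) := by ring
      _ ≤ n := by linarith
  have hrk' : r * k ≤ n := by exact_mod_cast hrk
  have d1 := DD_bound n n k L hL1 hn hk h2a h2b le_rfl (by omega) h2k (by linarith)
  have d2 := DD_bound (n + r * k) n k L hL1 hn hk h2a h2b (by omega) (by omega) h2k (by linarith)
  have m2 : muk (n + r * k) k ≤ 2 * M := by rw [hM] at *; linarith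
  -- common bound
  set Δ := 384 * L ^ 6 * M / n with hΔ
  have hΔ0 : 0 < Δ := by positivity
  have d1' : DD n k ≤ Δ := by
    refine d1.trans ?_
    rw [hΔ, ← hM]
    have : 128 * L ^ 6 * (1 + M) ≤ 128 * L ^ 6 * (3 * M) := by gcongr; linarith
    apply div_le_div_of_nonneg_right _ hn0.le
    linarith
  have d2' : DD (n + r * k) k ≤ Δ := by
    refine d2.trans ?_
    rw [hΔ]
    have : 128 * L ^ 6 * (1 + muk (n + r * k) k) ≤ 128 * L ^ 6 * (3 * M) := by gcongr; linarith
    apply div_le_div_of_nonneg_right _ hn0.le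
    linarith
  have hMΔ : M * Δ ≤ 384 * τ := by
    rw [hΔ, mul_div_assoc', div_le_iff₀ hn0]
    have e : M * (384 * L ^ 6 * M) = 384 * (L ^ 6 * M ^ 2) := by ring
    rw [e]
    linarith
  have hLn : 3 * L ≤ n := by linarith
  have hk3 : 3 ≤ k := by
    by_contra hc
    have : k ≤ 2 := by omega
    have h1 : (2 : ℝ) ^ k ≤ 2 ^ 2 := pow_le_pow_right₀ (by norm_num) this
    have h2 : 3 ≤ (n : ℝ) / L := by rw [le_div_iff₀ hL0]; exact hLn
    nlinarith
  have hpi : pik k ≤ Δ := by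
    have h1 : k ≤ k.choose 2 := by
      have := two_choose k
      obtain ⟨a, rfl⟩ : ∃ a, k = a + 3 := ⟨k - 3, by omega⟩
      have e : a + 3 - 1 = a + 2 := by omega
      rw [e] at this
      nlinarith
    calc pik k ≤ (2 : ℝ)⁻¹ ^ k := by
          unfold pik; exact pow_le_pow_of_le_one (by norm_num) (by norm_num) h1
      _ = ((2 : ℝ) ^ k)⁻¹ := by rw [inv_pow]
      _ ≤ (((n : ℝ) / L) ^ 2)⁻¹ := by gcongr
      _ = L ^ 2 / n / n := by field_simp
      _ ≤ L ^ 2 / n := by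
          apply div_le_self (by positivity)
          exact_mod_cast hn
      _ ≤ Δ := by
          rw [hΔ]
          apply div_le_div_of_nonneg_right _ hn0.le
          have : L ^ 2 ≤ L ^ 6 := pow_le_pow_right₀ hL1 (by norm_num)
          have h6 : 0 < L ^ 6 := by positivity
          nlinarith
  have hD0 := DD_nonneg n k
  have hD0' := DD_nonneg (n + r * k) k
  refine ⟨g1, g2, ?_, ?_, ?_, ?_⟩
  · calc s * (pik k + DD n k) ≤ M * (Δ + Δ) := by
          apply mul_le_mul hsM (by linarith) _ (by linarith)
          have := pik_pos k
          linarith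
      _ ≤ _ := by linarith
  · calc 2 * s * (pik k + DD (n + r * k) k) ≤ 2 * M * (Δ + Δ) := by
          apply mul_le_mul (by linarith) (by linarith) _ (by linarith)
          have := pik_pos k
          linarith
      _ ≤ _ := by linarith
  · calc muk n k * DD n k ≤ M * Δ := by
          rw [← hM]; gcongr
      _ ≤ _ := by linarith
  · calc muk (n + r * k) k * DD (n + r * k) k ≤ 2 * M * Δ := by
          apply mul_le_mul m2 d2' hD0' (by linarith)
      _ ≤ _ := by linarith

lemma aa_bounds (n : ℕ) (L : ℝ) (hL : L = Real.logb 2 n) (hL3 : 3 ≤ L) (hLn : L ≤ n) :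
    (aa n : ℝ) ≤ 2 * L ∧ ((n : ℝ) / L) ^ 2 ≤ (2 : ℝ) ^ (aa n) ∧ (2 : ℝ) ^ (aa n) ≤ (n : ℝ) ^ 2 := by
  have hL0 : 0 < L := by linarith
  have hn0 : (0 : ℝ) < n := by linarith
  have he1 : 2 ≤ Real.exp 1 := by have := Real.add_one_le_exp 1; linarith
  have he2 : Real.exp 1 < 3 := by have := Real.exp_one_lt_d9; linarith
  have hα : (2 : ℝ) ^ (alpha0 n) = ((n : ℝ) / L) ^ 2 * (Real.exp 1 / 2) ^ 2 * 2 := by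
    have h1 : (2 : ℝ) ^ L = n := by
      rw [hL]; exact Real.rpow_logb (by norm_num) (by norm_num) hn0
    have h2 : (2 : ℝ) ^ (Real.logb 2 L) = L := Real.rpow_logb (by norm_num) (by norm_num) hL0
    have h3 : (2 : ℝ) ^ (Real.logb 2 (Real.exp 1 / 2)) = Real.exp 1 / 2 :=
      Real.rpow_logb (by norm_num) (by norm_num) (by positivity)
    unfold alpha0
    rw [← hL, Real.rpow_add (by norm_num), Real.rpow_add (by norm_num), Real.rpow_sub (by norm_num),
      mul_comm 2 L, mul_comm 2 (Real.logb 2 L), mul_comm 2 (Real.logb 2 (Real.exp 1 / 2)),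
      Real.rpow_mul (by norm_num), Real.rpow_mul (by norm_num), Real.rpow_mul (by norm_num),
      h1, h2, h3, Real.rpow_one, Real.rpow_two, Real.rpow_two, Real.rpow_two, div_pow (n : ℝ) L]
  have hnL : 1 ≤ (n : ℝ) / L := by rw [le_div_iff₀ hL0]; linarith
  have hE : 1 ≤ Real.exp 1 / 2 := by linarith
  have hlow : ((n : ℝ) / L) ^ 2 * 2 ≤ (2 : ℝ) ^ (alpha0 n) := by
    rw [hα]
    have : 1 ≤ (Real.exp 1 / 2) ^ 2 := one_le_pow₀ hE
    have h0 : 0 ≤ ((n : ℝ) / L) ^ 2 := by positivity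
    nlinarith
  have hup : (2 : ℝ) ^ (alpha0 n) ≤ (n : ℝ) ^ 2 := by
    rw [hα, div_pow, div_mul_eq_mul_div, div_mul_eq_mul_div, div_le_iff₀ (by positivity)]
    have : (Real.exp 1 / 2) ^ 2 * 2 ≤ L ^ 2 := by nlinarith
    calc (n : ℝ) ^ 2 * (Real.exp 1 / 2) ^ 2 * 2 = (n : ℝ) ^ 2 * ((Real.exp 1 / 2) ^ 2 * 2) := by ring
      _ ≤ _ := by gcongr
  have hα0 : 0 ≤ alpha0 n := by
    by_contra hc
    push Not at hc
    have h1 := Real.rpow_lt_one_of_one_lt_of_neg (x := 2) (by norm_num) hc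
    have h2 : 1 ≤ ((n : ℝ) / L) ^ 2 := one_le_pow₀ hnL
    linarith
  have f1 : (aa n : ℝ) ≤ alpha0 n := Nat.floor_le hα0
  have f2 : alpha0 n < (aa n : ℝ) + 1 := Nat.lt_floor_add_one _
  have hb : (2 : ℝ) ^ (aa n) ≤ (n : ℝ) ^ 2 := by
    rw [← Real.rpow_natCast]
    exact le_trans (Real.rpow_le_rpow_of_exponent_le (by norm_num) f1) hup
  refine ⟨?_, ?_, hb⟩
  · have h1 : Real.logb 2 ((2 : ℝ) ^ (aa n)) ≤ Real.logb 2 ((n : ℝ) ^ 2) :=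
      Real.logb_le_logb_of_le (by norm_num) (by positivity) hb
    rw [Real.logb_pow, Real.logb_pow, Real.logb_self_eq_one (by norm_num), ← hL] at h1
    push_cast at h1
    linarith
  · have h1 : (2 : ℝ) ^ (alpha0 n) ≤ (2 : ℝ) ^ ((aa n : ℝ) + 1) :=
      Real.rpow_le_rpow_of_exponent_le (by norm_num) f2.le
    rw [Real.rpow_add (by norm_num), Real.rpow_one, Real.rpow_natCast] at h1
    linarith

lemma Pr_not (m : ℕ) (B : SimpleGraph (Fin m) → Prop) :
    Pr m (fun G => ¬ B G) = 1 - Pr m B := by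
  rw [Pr_eq, Pr_eq, eq_sub_iff_add_eq, ← Ex_add]
  have : ∀ G : SimpleGraph (Fin m), ind (¬ B G) + ind (B G) = 1 := by
    intro G; unfold ind; by_cases h : B G <;> simp [h]
  simp_rw [this]
  exact Ex_const 1

lemma ev_log (ε τ : ℝ) (hε : 0 < ε) (hτ : 0 < τ) :
    ∀ᶠ n : ℕ in atTop, (Real.logb 2 n) ^ 6 ≤ τ * (n : ℝ) ^ (2 * ε) := by
  have h1 : (fun x : ℝ => Real.log x ^ 6) =o[atTop] fun x => x ^ (2 * ε) := by
    have := isLittleO_log_rpow_rpow_atTop (s := 2 * ε) 6 (by linarith)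
    refine this.congr_left ?_
    intro x
    exact_mod_cast Real.rpow_natCast (Real.log x) 6
  have hc : 0 < τ * Real.log 2 ^ 6 := by
    have := Real.log_pos (x := 2) (by norm_num)
    positivity
  have h2 := (h1.def hc)
  have h3 := tendsto_natCast_atTop_atTop (R := ℝ) |>.eventually h2
  filter_upwards [h3] with n hn
  have hl := Real.log_pos (x := 2) (by norm_num)
  rw [Real.norm_eq_abs, Real.norm_eq_abs, abs_of_nonneg (by positivity),
    abs_of_nonneg (by positivity)] at hn
  unfold Real.logb
  rw [div_pow, div_le_iff₀ (by positivity)]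
  linarith

end Final
/-- Selection of typical values: for large `n` with `ε < x(n) < 1/2 − ε`, there is an
integer `A ∈ [n^{x(n)}/2, 2 n^{x(n)}]` such that, conditionally on `{X_a = A} ∩ E`
(resp. `{X′_a = A + r} ∩ E′`), the chromatic number of `G(n,1/2)` (resp. `G(n′,1/2)`)
lies in `[s_n, t_n]` (resp. `[s_{n′}, t_{n′}]`) with probability more than `3/4`. -/
theorem stmt10 (ε : ℝ) (hε : 0 < ε) (hε4 : ε < 1/4) (s t : ℕ → ℝ)
    (hst : Tendsto (fun n : ℕ => Pr n (fun G => (chi n G : ℝ) ∈ Set.Icc (s n) (t n)))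
      atTop (nhds 1)) :
    ∃ N : ℕ, ∀ n ≥ N, ε < xx n → xx n < 1/2 - ε →
      ∃ A : ℕ, (n : ℝ) ^ (xx n) / 2 ≤ (A : ℝ) ∧ (A : ℝ) ≤ 2 * (n : ℝ) ^ (xx n) ∧
        (let r : ℕ := ⌊(n : ℝ) ^ (xx n / 2)⌋₊
         let n' : ℕ := n + r * aa n
         condPr n (fun G => (chi n G : ℝ) ∈ Set.Icc (s n) (t n))
            (fun G => numIndep n (aa n) G = A ∧ AllDisjoint n (aa n) G) > 3/4 ∧
         condPr n' (fun G => (chi n' G : ℝ) ∈ Set.Icc (s n') (t n'))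
            (fun G => numIndep n' (aa n) G = A + r ∧ AllDisjoint n' (aa n) G) > 3/4) := by

  have hc0 := Real.exp_pos (-50)
  have hc1 : Real.exp (-50) ≤ 1 := Real.exp_le_one_iff.2 (by norm_num)
  obtain ⟨τ, hτ⟩ : ∃ τ, τ = Real.exp (-50) / 10000000 := ⟨_, rfl⟩
  have hτ0 : 0 < τ := by rw [hτ]; positivity
  have hev1 : ∀ᶠ n : ℕ in atTop, 1 - τ < Pr n (fun G => (chi n G : ℝ) ∈ Set.Icc (s n) (t n)) :=
    hst.eventually (lt_mem_nhds (by linarith))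
  obtain ⟨N1, hN1⟩ := eventually_atTop.1 hev1
  have hev2 : ∀ᶠ n : ℕ in atTop, 3 ≤ Real.logb 2 n :=
    ((Real.tendsto_logb_atTop (by norm_num : (1:ℝ) < 2)).comp
      tendsto_natCast_atTop_atTop).eventually_ge_atTop 3
  have hev3 : ∀ᶠ n : ℕ in atTop, 100 ≤ (n : ℝ) ^ ε :=
    ((tendsto_rpow_atTop hε).comp tendsto_natCast_atTop_atTop).eventually_ge_atTop 100
  obtain ⟨N2, hN2⟩ := eventually_atTop.1 (hev2.and (hev3.and (ev_log ε τ hε hτ0)))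
  refine ⟨max (max N1 N2) 2, ?_⟩
  intro n hn hx1 hx2
  have hn1 : N1 ≤ n := le_trans (le_trans (le_max_left _ _) (le_max_left _ _)) hn
  have hn2 : N2 ≤ n := le_trans (le_trans (le_max_right _ _) (le_max_left _ _)) hn
  have hn3 : 2 ≤ n := le_trans (le_max_right _ _) hn
  have hnR : (2 : ℝ) ≤ n := by exact_mod_cast hn3
  have hn0 : (0 : ℝ) < n := by linarith
  have hn1R : (1 : ℝ) < n := by linarith
  obtain ⟨hL3, h100, hlog⟩ := hN2 n hn2
  obtain ⟨L, hL⟩ : ∃ L, L = Real.logb 2 n := ⟨_, rfl⟩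
  rw [← hL] at hL3 hlog
  have hlogn : 0 < Real.log n := Real.log_pos hn1R
  have hmu0 : 0 < mu n := by
    have h0 : 0 ≤ mu n := by unfold mu; positivity
    rcases h0.lt_or_eq with h | h
    · exact h
    · exfalso
      have : xx n = 0 := by unfold xx; rw [← h]; simp
      linarith
  have hpow : (n : ℝ) ^ (xx n) = mu n := by
    rw [Real.rpow_def_of_pos hn0]
    unfold xx
    rw [mul_div_cancel₀ _ hlogn.ne', Real.exp_log hmu0]
  have hMlow : 100 ≤ mu n := by
    rw [← hpow]
    exact h100.trans (Real.rpow_le_rpow_of_exponent_le hn1R.le hx1.le)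
  have hMup : mu n ^ 2 * (n : ℝ) ^ (2 * ε) ≤ n := by
    rw [← hpow, ← Real.rpow_natCast, ← Real.rpow_mul hn0.le, ← Real.rpow_add hn0]
    calc _ ≤ (n : ℝ) ^ (1 : ℝ) :=
          Real.rpow_le_rpow_of_exponent_le hn1R.le (by push_cast; linarith)
      _ = n := Real.rpow_one _
  have hmain : L ^ 6 * mu n ^ 2 ≤ τ * n := by
    calc L ^ 6 * mu n ^ 2 ≤ (τ * (n : ℝ) ^ (2 * ε)) * mu n ^ 2 := by gcongr
      _ = τ * (mu n ^ 2 * (n : ℝ) ^ (2 * ε)) := by ring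
      _ ≤ _ := by gcongr
  have hLn : L ≤ n := by
    have h1 : L ≤ L ^ 6 := le_self_pow₀ (by linarith) (by norm_num)
    have h2 : 1 ≤ mu n ^ 2 := one_le_pow₀ (by linarith)
    have h3 : τ * n ≤ 1 * n := by
      gcongr
      rw [hτ]; linarith
    nlinarith [pow_pos (by linarith : 0 < L) 6]
  obtain ⟨ha1, ha2, ha3⟩ := aa_bounds n L hL hL3 hLn
  have hsq : ((n : ℝ) ^ (xx n / 2)) ^ 2 = mu n := by
    rw [← hpow, ← Real.rpow_natCast, ← Real.rpow_mul hn0.le]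
    congr 1
    push_cast
    ring
  obtain ⟨σ, hσ⟩ : ∃ σ, σ = (n : ℝ) ^ (xx n / 2) := ⟨_, rfl⟩
  rw [← hσ] at hsq
  have hσ0 : 0 < σ := by rw [hσ]; positivity
  have hσ10 : 10 ≤ σ := by nlinarith
  have hmk : mu n = muk n (aa n) := rfl
  rw [← hσ, hpow]
  obtain ⟨r, hr⟩ : ∃ r, r = ⌊σ⌋₊ := ⟨_, rfl⟩
  rw [← hr]
  obtain ⟨b1, b2, b3, b4, b5, b6⟩ := final_bounds n (aa n) r L (mu n) σ τ hmk hsq hσ10 hr hL3 ha1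
    ha2 ha3 hτ0 (by rw [hτ]; linarith) (by omega) hmain
  have p1 := hN1 n hn1
  have p2 := hN1 (n + r * aa n) (by omega)
  obtain ⟨A, hA1, hA2, hA3, hA4⟩ := select n (n + r * aa n) (aa n) r σ
    (fun G => (chi n G : ℝ) ∈ Set.Icc (s n) (t n))
    (fun G => (chi (n + r * aa n) G : ℝ) ∈ Set.Icc (s (n + r * aa n)) (t (n + r * aa n)))
    hsq hσ10 hr b1 b2 (by rw [hτ] at b3; linarith) (by rw [hτ] at b4; linarith) (by
      rw [Pr_not, Pr_not]
      have : τ * 10000000 = Real.exp (-50) := by rw [hτ]; ring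
      linarith)
  rw [← hmk] at hA1 hA2
  refine ⟨A, by linarith, ?_, hA3, hA4⟩
  nlinarith
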